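/- arXiv:2307.02193 — 6 statements merged into one kernel-verified Lean document; each statement's English description precedes it below -/
import Mathlib

section
/- Let B̄ ⊂ ℝⁿ be the closure of the box B = (0,a₁) × ⋯ × (0,aₙ) of size a ∈ ℝⁿ with all a_i > 0, and let f : B̄ → ℝ be Lipschitz continuous with monotone rearrangement f* = R_n ⋯ R_1 f. Then ∫_B |f − f*| dν ≤ 2·Σ_{i=1}^n a_i · ∫_B |∂⁻_i f| dν, where ν is the Lebesgue measure. -/
open MeasureTheory

/-- The (lower) level set `{y ∈ [0,m] : g y ≤ c}`. -/
def levelSet (m : ℝ) (g : ℝ → ℝ) (c : ℝ) : Set ℝ :=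
  {y : ℝ | y ∈ Set.Icc 0 m ∧ g y ≤ c}

/-- One-dimensional non-symmetric non-decreasing monotone rearrangement of `g` on `[0,m]`:
`g* x = inf {c : x ∈ (levelSet m g c)*}`, where `S* = [0, ν S]` for nonempty `S` and
`∅* = ∅`. -/
noncomputable def rearr1 (m : ℝ) (g : ℝ → ℝ) (x : ℝ) : ℝ :=
  sInf {c : ℝ | (levelSet m g c).Nonempty ∧ 0 ≤ x ∧
    ENNReal.ofReal x ≤ volume (levelSet m g c)}

/-- The rearrangement operator in direction `i` on the box `[0,a₁] × ⋯ × [0,aₙ]`: on every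
line in direction `i`, it is the one-dimensional monotone rearrangement of the restriction
of `f` to that line. -/
noncomputable def rearrDir {n : ℕ} (a : Fin n → ℝ) (i : Fin n) (f : (Fin n → ℝ) → ℝ) :
    (Fin n → ℝ) → ℝ :=
  fun x => rearr1 (a i) (fun t => f (Function.update x i t)) (x i)

/-- The monotone rearrangement `f* = Rₙ Rₙ₋₁ ⋯ R₁ f`. -/
noncomputable def monoRearr {n : ℕ} (a : Fin n → ℝ) (f : (Fin n → ℝ) → ℝ) :
    (Fin n → ℝ) → ℝ :=
  (List.finRange n).foldl (fun g i => rearrDir a i g) f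

/-- The partial derivative of `f` in coordinate `i` at `x` (junk value where the line
restriction of `f` is not differentiable). -/
noncomputable def pdiff {n : ℕ} (i : Fin n) (f : (Fin n → ℝ) → ℝ) (x : Fin n → ℝ) : ℝ :=
  deriv (fun t => f (Function.update x i t)) (x i)

open Set Filter Topology ENNReal

/-- Lebesgue measure on the open interval `(0, m)`. -/
noncomputable abbrev ivol (m : ℝ) : Measure ℝ := volume.restrict (Ioo 0 m)

/-- The monotone rearrangement on the open interval `(0, m)`, extended by zero. -/
noncomputable def rearrIoo (m : ℝ) (g : ℝ → ℝ) (x : ℝ) : ℝ :=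
  open Classical in
  if x ∈ Ioo 0 m then sInf {c : ℝ | ENNReal.ofReal x ≤ ivol m {y | g y ≤ c}} else 0

lemma ivol_Ioc {m x : ℝ} (hx : x ∈ Ioo 0 m) : ivol m (Ioc 0 x) = ENNReal.ofReal x := by
  rw [Measure.restrict_apply measurableSet_Ioc, inter_eq_left.2]
  · simp
  · exact fun y hy => ⟨hy.1, hy.2.trans_lt hx.2⟩

lemma bddBelow_levels {m M x : ℝ} {g : ℝ → ℝ} (hb : ∀ y, |g y| ≤ M) (hx : x ∈ Ioo 0 m) :
    -M ∈ lowerBounds {c : ℝ | ENNReal.ofReal x ≤ ivol m {y | g y ≤ c}} := by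
  intro c hc
  by_contra! h
  have : {y | g y ≤ c} = ∅ := by
    ext y
    simpa using h.trans_le (neg_le_of_abs_le (hb y))
  rw [mem_ofPred_eq, this, measure_empty, nonpos_iff_eq_zero, ENNReal.ofReal_eq_zero] at hc
  exact hc.not_gt hx.1

lemma bound_mem_levels {m M x : ℝ} {g : ℝ → ℝ} (hb : ∀ y, |g y| ≤ M) (hx : x ∈ Ioo 0 m) :
    ENNReal.ofReal x ≤ ivol m {y | g y ≤ M} := by
  have : {y | g y ≤ M} = univ := by
    ext y
    simpa using le_of_abs_le (hb y)
  rw [this]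
  exact (ivol_Ioc hx).symm.le.trans (measure_mono (subset_univ _))

lemma rearrIoo_le_iff {m M x c : ℝ} {g : ℝ → ℝ} (hg : Measurable g) (hb : ∀ y, |g y| ≤ M)
    (hx : x ∈ Ioo 0 m) :
    rearrIoo m g x ≤ c ↔ ENNReal.ofReal x ≤ ivol m {y | g y ≤ c} := by
  rw [rearrIoo, if_pos hx]
  refine ⟨fun h => ?_, fun h => csInf_le ⟨_, bddBelow_levels hb hx⟩ h⟩
  have key : ∀ c' > c, ENNReal.ofReal x ≤ ivol m {y | g y ≤ c'} := by
    intro c' hc'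
    obtain ⟨b, hb1, hb2⟩ := exists_lt_of_csInf_lt ⟨M, bound_mem_levels hb hx⟩ (h.trans_lt hc')
    exact le_trans hb1 (measure_mono fun y hy => le_trans hy hb2.le)
  have ht := tendsto_measure_biInter_gt (μ := ivol m) (s := fun r => {y | g y ≤ r}) (a := c)
    (fun r _ => (measurableSet_le hg measurable_const).nullMeasurableSet)
    (fun i j _ hij y hy => le_trans hy hij) ⟨c + 1, by simp, measure_ne_top _ _⟩
  have : (⋂ r > c, {y | g y ≤ r}) = {y | g y ≤ c} := by
    ext y
    simp only [mem_iInter, mem_ofPred_eq]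
    exact ⟨fun H => le_of_forall_gt_imp_ge_of_dense H, fun H r hr => H.trans (le_of_lt hr)⟩
  rw [this] at ht
  exact ge_of_tendsto ht (eventually_mem_nhdsWithin.mono key)

lemma abs_rearrIoo_le {m M : ℝ} {g : ℝ → ℝ} (hg : Measurable g) (hb : ∀ y, |g y| ≤ M) (x : ℝ) :
    |rearrIoo m g x| ≤ M := by
  by_cases hx : x ∈ Ioo 0 m
  · refine abs_le.2 ⟨?_, (rearrIoo_le_iff hg hb hx).2 (bound_mem_levels hb hx)⟩
    rw [rearrIoo, if_pos hx]
    exact le_csInf ⟨M, bound_mem_levels hb hx⟩ (bddBelow_levels hb hx)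
  · simpa [rearrIoo, hx] using (abs_nonneg _).trans (hb 0)

lemma rearrIoo_le_add {m M M' D : ℝ} {g g' : ℝ → ℝ} (hg : Measurable g) (hb : ∀ y, |g y| ≤ M)
    (hg' : Measurable g') (hb' : ∀ y, |g' y| ≤ M') (hD : 0 ≤ D)
    (h : ∀ y, g y ≤ g' y + D) (x : ℝ) : rearrIoo m g x ≤ rearrIoo m g' x + D := by
  by_cases hx : x ∈ Ioo 0 m
  · rw [rearrIoo_le_iff hg hb hx]
    refine ((rearrIoo_le_iff hg' hb' hx).1 le_rfl).trans (measure_mono fun y hy => ?_)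
    exact (h y).trans (add_le_add_left hy D)
  · simpa [rearrIoo, hx] using hD

lemma measurable_rearrIoo {m M : ℝ} {g : ℝ → ℝ} (hg : Measurable g) (hb : ∀ y, |g y| ≤ M) :
    Measurable (rearrIoo m g) := by
  refine measurable_of_Iic fun c => ?_
  have : rearrIoo m g ⁻¹' Iic c =
      (Ioo 0 m ∩ {x | ENNReal.ofReal x ≤ ivol m {y | g y ≤ c}}) ∪ ((Ioo 0 m)ᶜ ∩ {_x | 0 ≤ c}) := by
    ext x
    by_cases hx : x ∈ Ioo 0 m
    · simp only [mem_preimage, mem_Iic, rearrIoo_le_iff hg hb hx]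
      simp [hx]
    · simp [rearrIoo, hx]
  rw [this]
  exact (measurableSet_Ioo.inter (measurableSet_le ENNReal.measurable_ofReal measurable_const)).union
    (measurableSet_Ioo.compl.inter (MeasurableSet.const _))

lemma lintegral_ofReal_sub_eq (μ : Measure ℝ) [SFinite μ] {u v : ℝ → ℝ} (hu : Measurable u)
    (hv : Measurable v) :
    ∫⁻ x, ENNReal.ofReal (u x - v x) ∂μ = ∫⁻ c, μ {x | v x ≤ c ∧ c < u x} := by
  have hS : MeasurableSet {p : ℝ × ℝ | v p.1 ≤ p.2 ∧ p.2 < u p.1} :=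
    (measurableSet_le (hv.comp measurable_fst) measurable_snd).inter
      (measurableSet_lt measurable_snd (hu.comp measurable_fst))
  have h1 := Measure.prod_apply (μ := μ) (ν := volume) hS
  rw [Measure.prod_apply_symm hS] at h1
  refine Eq.trans (lintegral_congr fun x => ?_) h1.symm
  rw [← Real.volume_Ico]
  rfl

/-- Rearrangement contracts the integral of the positive part of a difference. -/
lemma lintegral_rearrIoo_sub_le {m M M' : ℝ} {g g' : ℝ → ℝ} (hg : Measurable g)
    (hb : ∀ y, |g y| ≤ M) (hg' : Measurable g') (hb' : ∀ y, |g' y| ≤ M') :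
    ∫⁻ x, ENNReal.ofReal (rearrIoo m g x - rearrIoo m g' x) ∂(ivol m) ≤
      ∫⁻ x, ENNReal.ofReal (g x - g' x) ∂(ivol m) := by
  rw [lintegral_ofReal_sub_eq _ hg hg', lintegral_ofReal_sub_eq _ (measurable_rearrIoo hg hb)
    (measurable_rearrIoo hg' hb')]
  refine lintegral_mono fun c => ?_
  set p := ivol m {y | g y ≤ c} with hp
  set q := ivol m {y | g' y ≤ c} with hq
  have hpt : p ≠ ∞ := measure_ne_top _ _
  have hqt : q ≠ ∞ := measure_ne_top _ _
  have hsub : {x | rearrIoo m g' x ≤ c ∧ c < rearrIoo m g x} ∩ Ioo 0 m ⊆ Ioc p.toReal q.toReal := by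
    rintro x ⟨⟨h1, h2⟩, hx⟩
    rw [rearrIoo_le_iff hg' hb' hx, ← hq, ENNReal.ofReal_le_iff_le_toReal hqt] at h1
    rw [← not_le, rearrIoo_le_iff hg hb hx, ← hp, ENNReal.ofReal_le_iff_le_toReal hpt, not_le] at h2
    exact ⟨h2, h1⟩
  calc ivol m {x | rearrIoo m g' x ≤ c ∧ c < rearrIoo m g x}
      = volume ({x | rearrIoo m g' x ≤ c ∧ c < rearrIoo m g x} ∩ Ioo 0 m) :=
        Measure.restrict_apply' measurableSet_Ioo
    _ ≤ volume (Ioc p.toReal q.toReal) := measure_mono hsub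
    _ = q - p := by
        rw [Real.volume_Ioc, ENNReal.ofReal_sub _ ENNReal.toReal_nonneg, ENNReal.ofReal_toReal hqt,
          ENNReal.ofReal_toReal hpt]
    _ ≤ ivol m ({y | g' y ≤ c} \ {y | g y ≤ c}) := le_measure_sdiff
    _ ≤ ivol m {x | g' x ≤ c ∧ c < g x} := measure_mono fun x hx => ⟨hx.1, not_le.1 hx.2⟩

lemma abs_sub_rearrIoo_le {m M D x : ℝ} {g : ℝ → ℝ} (hg : Continuous g) (hb : ∀ y, |g y| ≤ M)
    (hD : 0 ≤ D) (h : ∀ y ∈ Ioo 0 m, ∀ z ∈ Ioo 0 m, y < z → g y - g z ≤ D) (hx : x ∈ Ioo 0 m) :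
    |g x - rearrIoo m g x| ≤ D := by
  rw [abs_sub_le_iff]
  constructor
  · by_contra! hlt
    set c := rearrIoo m g x with hc
    have h1 := (rearrIoo_le_iff hg.measurable hb hx).1 hc.symm.le
    have hev : ∀ᶠ y in 𝓝[<] x, y ∈ Ioo 0 x ∧ c + D < g y :=
      Filter.Eventually.and (Ioo_mem_nhdsLT hx.1)
        ((hg.continuousAt.mono_left nhdsWithin_le_nhds).eventually (lt_mem_nhds (by linarith)))
    obtain ⟨y, hy, hyc⟩ := hev.exists
    have hym : y ∈ Ioo 0 m := ⟨hy.1, hy.2.trans hx.2⟩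
    have hle : ivol m {z | g z ≤ c} ≤ ivol m (Ioc 0 y) := by
      rw [Measure.restrict_apply' measurableSet_Ioo, Measure.restrict_apply' measurableSet_Ioo]
      refine measure_mono ?_
      rintro z ⟨hz, hzm⟩
      refine ⟨⟨hzm.1, ?_⟩, hzm⟩
      by_contra! hyz
      have := h y hym z hzm hyz
      have : g z ≤ c := hz
      linarith
    rw [ivol_Ioc hym] at hle
    have := (ENNReal.ofReal_le_ofReal_iff hy.1.le).1 (h1.trans hle)
    exact this.not_gt hy.2
  · have : rearrIoo m g x ≤ g x + D := by
      rw [rearrIoo_le_iff hg.measurable hb hx, ← ivol_Ioc hx]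
      rw [Measure.restrict_apply' measurableSet_Ioo, Measure.restrict_apply' measurableSet_Ioo]
      refine measure_mono ?_
      rintro z ⟨hz, hzm⟩
      refine ⟨?_, hzm⟩
      rcases hz.2.eq_or_lt with rfl | hlt
      · simpa using hD
      · have := h z hzm x hx hlt
        simp only [mem_ofPred_eq]
        linarith
    linarith

lemma sub_le_of_lipschitz {m h y z : ℝ} {K : NNReal} {g : ℝ → ℝ} (hg : LipschitzWith K g)
    (hh : 0 < h) (hy : y ∈ Ioo 0 m) (hz : z ∈ Ioo 0 m) (hyz : y < z) :
    g y - g z ≤ 2 * K * h + (∫ t, max (g t - g (t + h)) 0 ∂(ivol m)) / h := by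
  have hc := hg.continuous
  have hi : ∀ p q : ℝ, IntervalIntegrable g volume p q := fun p q => hc.intervalIntegrable p q
  have hl : ∀ s t : ℝ, |g s - g t| ≤ K * |s - t| := fun s t => by
    simpa [Real.dist_eq] using hg.dist_le_mul s t
  have e1 : ∫ t in y..z, (g t - g (t + h)) =
      (∫ t in y..y + h, g t) - ∫ t in z..z + h, g t := by
    rw [intervalIntegral.integral_sub (hi _ _)
      ((by fun_prop : Continuous fun t => g (t + h)).intervalIntegrable _ _),
      intervalIntegral.integral_comp_add_right (fun t => g t) h]
    exact intervalIntegral.integral_interval_sub_interval_comm (hi _ _) (hi _ _) (hi _ _)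
  have e2 : h * (g y - K * h) ≤ ∫ t in y..y + h, g t := by
    have := intervalIntegral.integral_mono_on (a := y) (b := y + h) (μ := volume)
      (f := fun _ => g y - K * h) (g := g) (by linarith) (by simp) (hi _ _) (fun t ht => by
        have h1 := (abs_le.1 (hl y t)).2
        have h2 : |y - t| ≤ h := by rw [abs_le]; constructor <;> linarith [ht.1, ht.2]
        have := mul_le_mul_of_nonneg_left h2 K.coe_nonneg
        linarith)
    simpa only [intervalIntegral.integral_const, add_sub_cancel_left, smul_eq_mul] using this
  have e3 : ∫ t in z..z + h, g t ≤ h * (g z + K * h) := by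
    have := intervalIntegral.integral_mono_on (a := z) (b := z + h) (μ := volume)
      (g := fun _ => g z + K * h) (f := g) (by linarith) (hi _ _) (by simp) (fun t ht => by
        have h1 := (abs_le.1 (hl z t)).1
        have h2 : |z - t| ≤ h := by rw [abs_le]; constructor <;> linarith [ht.1, ht.2]
        have := mul_le_mul_of_nonneg_left h2 K.coe_nonneg
        linarith)
    simpa only [intervalIntegral.integral_const, add_sub_cancel_left, smul_eq_mul] using this
  have hcm : Continuous fun t => max (g t - g (t + h)) 0 := by fun_prop
  have e4 : ∫ t in y..z, (g t - g (t + h)) ≤ ∫ t, max (g t - g (t + h)) 0 ∂(ivol m) := by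
    calc ∫ t in y..z, (g t - g (t + h)) ≤ ∫ t in y..z, max (g t - g (t + h)) 0 :=
          intervalIntegral.integral_mono hyz.le
            (((hc.sub (hc.comp (continuous_add_const h)))).intervalIntegrable _ _)
            (hcm.intervalIntegrable _ _) (fun t => le_max_left _ _)
      _ = ∫ t in Ioc y z, max (g t - g (t + h)) 0 := intervalIntegral.integral_of_le hyz.le
      _ ≤ _ := setIntegral_mono_set
          ((hcm.integrableOn_Icc (a := 0) (b := m)).mono_set Ioo_subset_Icc_self)
          (ae_of_all _ fun t => le_max_right _ _)
          (LE.le.eventuallyLE fun t ht => ⟨hy.1.trans ht.1, ht.2.trans_lt hz.2⟩)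
  rw [← sub_le_iff_le_add', le_div_iff₀ hh]
  nlinarith

lemma lintegral_sub_rearrIoo_le {m M h : ℝ} {K : NNReal} {g : ℝ → ℝ} (hm : 0 < m)
    (hg : LipschitzWith K g) (hb : ∀ y, |g y| ≤ M) (hh : 0 < h) :
    ∫⁻ x, ENNReal.ofReal |g x - rearrIoo m g x| ∂(ivol m) ≤
      ∫⁻ x, (ENNReal.ofReal (2 * K * h) +
        ENNReal.ofReal (m / h) * ENNReal.ofReal (g x - g (x + h))) ∂(ivol m) := by
  have hc := hg.continuous
  set W := ∫ t, max (g t - g (t + h)) 0 ∂(ivol m) with hW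
  have hcm : Continuous fun t => max (g t - g (t + h)) 0 := by fun_prop
  have hW0 : 0 ≤ W := integral_nonneg fun t => le_max_right _ _
  have hWl : ENNReal.ofReal W = ∫⁻ x, ENNReal.ofReal (g x - g (x + h)) ∂(ivol m) := by
    rw [hW, ofReal_integral_eq_lintegral_ofReal
      ((hcm.integrableOn_Icc (a := 0) (b := m)).mono_set Ioo_subset_Icc_self)
      (ae_of_all _ fun t => le_max_right _ _)]
    refine lintegral_congr fun t => ?_
    rw [ENNReal.ofReal_max]
    simp
  have hvol : ivol m univ = ENNReal.ofReal m := by simp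
  calc ∫⁻ x, ENNReal.ofReal |g x - rearrIoo m g x| ∂(ivol m)
      ≤ ∫⁻ x, ENNReal.ofReal (2 * K * h + W / h) ∂(ivol m) := by
        refine setLIntegral_mono measurable_const fun x hx => ENNReal.ofReal_le_ofReal ?_
        exact abs_sub_rearrIoo_le hc hb (by positivity)
          (fun y hy z hz hyz => sub_le_of_lipschitz hg hh hy hz hyz) hx
    _ = _ := by
        rw [lintegral_const, lintegral_add_left measurable_const, lintegral_const,
          lintegral_const_mul _ (by fun_prop), ← hWl, hvol, ← ENNReal.ofReal_mul (by positivity),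
          ← ENNReal.ofReal_mul (by positivity), ← ENNReal.ofReal_mul (by positivity),
          ← ENNReal.ofReal_add (by positivity) (by positivity)]
        congr 1
        field_simp

lemma lintegral_sub_shift_le {m h : ℝ} {K : NNReal} {g : ℝ → ℝ} (hg : LipschitzWith K g)
    (hh : 0 < h) (hc : ∀ t, m ≤ t → g t = g m) :
    ∫⁻ t, ENNReal.ofReal (g t - g (t + h)) ∂(ivol m) ≤
      ENNReal.ofReal h * ∫⁻ t, ENNReal.ofReal |min 0 (deriv g t)| ∂(ivol m) := by
  have hmeas : Measurable fun t => ENNReal.ofReal |min 0 (deriv g t)| :=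
    ((measurable_const.min (measurable_deriv g)).abs).ennreal_ofReal
  have habs : Measurable fun t => |min 0 (deriv g t)| :=
    (measurable_const.min (measurable_deriv g)).abs
  have hbd : ∀ t, |min 0 (deriv g t)| ≤ K := fun t => by
    have h1 := abs_le.1 (norm_deriv_le_of_lipschitz (x₀ := t) hg)
    rw [abs_le]
    exact ⟨le_min (by simp) h1.1, (min_le_left _ _).trans K.coe_nonneg⟩
  have pt : ∀ t, ENNReal.ofReal (g t - g (t + h)) ≤
      ∫⁻ s in Ioc 0 h, ENNReal.ofReal |min 0 (deriv g (t + s))| := by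
    intro t
    have hac : AbsolutelyContinuousOnInterval g t (t + h) :=
      (hg.lipschitzOnWith).absolutelyContinuousOnInterval
    have hint : IntervalIntegrable (fun s => |min 0 (deriv g s)|) volume t (t + h) := by
      refine (intervalIntegrable_const (c := (K : ℝ))).mono_fun habs.aestronglyMeasurable
        (ae_of_all _ fun s => ?_)
      simpa using hbd s
    have h1 : g t - g (t + h) ≤ ∫ s in t..t + h, |min 0 (deriv g s)| := by
      rw [← neg_sub, ← hac.integral_deriv_eq_sub, ← intervalIntegral.integral_neg]
      refine intervalIntegral.integral_mono (by linarith) hac.intervalIntegrable_deriv.neg hint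
        fun s => ?_
      exact (neg_le_neg (min_le_right 0 _)).trans (neg_le_abs _)
    have h2 : ∫ s in t..t + h, |min 0 (deriv g s)| =
        ∫ s in (0 : ℝ)..h, |min 0 (deriv g (t + s))| := by
      rw [intervalIntegral.integral_comp_add_left (fun s => |min 0 (deriv g s)|)]
      simp
    rw [h2, intervalIntegral.integral_of_le hh.le] at h1
    refine (ENNReal.ofReal_le_ofReal h1).trans ?_
    rw [ofReal_integral_eq_lintegral_ofReal]
    · refine Integrable.mono' (integrable_const (K : ℝ))
        (habs.comp (measurable_const_add t)).aestronglyMeasurable (ae_of_all _ fun s => ?_)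
      simpa using hbd (t + s)
    · exact ae_of_all _ fun s => abs_nonneg _
  have hzero : ∀ t, m < t → deriv g t = 0 := by
    intro t ht
    have : g =ᶠ[𝓝 t] fun _ => g m := (lt_mem_nhds ht).mono fun s hs => hc s hs.le
    rw [this.deriv_eq, deriv_const]
  calc ∫⁻ t, ENNReal.ofReal (g t - g (t + h)) ∂(ivol m)
      ≤ ∫⁻ t, (∫⁻ s in Ioc 0 h, ENNReal.ofReal |min 0 (deriv g (t + s))|) ∂(ivol m) :=
        lintegral_mono pt
    _ = ∫⁻ s in Ioc 0 h, (∫⁻ t, ENNReal.ofReal |min 0 (deriv g (t + s))| ∂(ivol m)) :=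
        lintegral_lintegral_swap (μ := ivol m) (ν := volume.restrict (Ioc 0 h))
          (f := fun t s => ENNReal.ofReal |min 0 (deriv g (t + s))|)
          (hmeas.comp (by fun_prop : Measurable fun p : ℝ × ℝ => p.1 + p.2)).aemeasurable
    _ ≤ ∫⁻ _s in Ioc 0 h, (∫⁻ t, ENNReal.ofReal |min 0 (deriv g t)| ∂(ivol m)) := by
        refine setLIntegral_mono measurable_const fun s hs => ?_
        calc ∫⁻ t, ENNReal.ofReal |min 0 (deriv g (t + s))| ∂(ivol m)
            = ∫⁻ t, (Ioo 0 m).indicator (fun t => ENNReal.ofReal |min 0 (deriv g (t + s))|) t :=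
              (lintegral_indicator measurableSet_Ioo _).symm
          _ ≤ ∫⁻ t, (Ioi 0).indicator (fun t => ENNReal.ofReal |min 0 (deriv g t)|) (t + s) := by
              refine lintegral_mono fun t => ?_
              by_cases ht : t ∈ Ioo 0 m
              · rw [indicator_of_mem ht, indicator_of_mem (s := Ioi 0) (add_pos ht.1 hs.1)]
              · simp [indicator_of_notMem ht]
          _ = ∫⁻ t, (Ioi 0).indicator (fun t => ENNReal.ofReal |min 0 (deriv g t)|) t :=
              lintegral_add_right_eq_self _ s
          _ ≤ ∫⁻ t, (Ioo 0 m).indicator (fun t => ENNReal.ofReal |min 0 (deriv g t)|) t := by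
              refine lintegral_mono_ae ?_
              filter_upwards [compl_mem_ae_iff.2 (measure_singleton (μ := volume) m)] with t ht
              rcases lt_or_gt_of_ne (show t ≠ m from ht) with h1 | h1
              · by_cases h0 : 0 < t
                · rw [indicator_of_mem (s := Ioo 0 m) ⟨h0, h1⟩]
                  exact indicator_le_self _ _ _
                · simp [h0]
              · by_cases h0 : 0 < t <;> simp [h0, hzero t h1]
          _ = _ := lintegral_indicator measurableSet_Ioo _
    _ = _ := by
        rw [setLIntegral_const, Real.volume_Ioc, sub_zero, mul_comm]

section Box

open Function

variable {n : ℕ}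

/-- Lebesgue measure on the open box with side lengths `a`. -/
noncomputable abbrev boxVol (a : Fin n → ℝ) : Measure (Fin n → ℝ) :=
  Measure.pi fun i => ivol (a i)

/-- Directional rearrangement on the open box, extended by zero in direction `i`. -/
noncomputable def rearrIooDir (a : Fin n → ℝ) (i : Fin n) (g : (Fin n → ℝ) → ℝ) :
    (Fin n → ℝ) → ℝ :=
  fun x => rearrIoo (a i) (fun t => g (update x i t)) (x i)

/-- Translation by `h` in direction `i`. -/
def shiftDir (i : Fin n) (h : ℝ) (x : Fin n → ℝ) : Fin n → ℝ := update x i (x i + h)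

/-- The integral of the positive part of the decrement of `g` over a step `h` in direction `i`. -/
noncomputable def decrement (a : Fin n → ℝ) (h : ℝ) (i : Fin n) (g : (Fin n → ℝ) → ℝ) : ℝ≥0∞ :=
  ∫⁻ x, ENNReal.ofReal (g x - g (shiftDir i h x)) ∂(boxVol a)

lemma measurable_shiftDir (i : Fin n) (h : ℝ) : Measurable (shiftDir i h) :=
  measurable_update'.comp
    (by fun_prop : Measurable fun x : Fin n → ℝ => ((x, x i + h) : (Fin n → ℝ) × ℝ))

lemma shiftDir_update_self (i : Fin n) (h t : ℝ) (x : Fin n → ℝ) :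
    shiftDir i h (update x i t) = update x i (t + h) := by
  simp [shiftDir]

lemma shiftDir_update_of_ne {i j : Fin n} (hij : i ≠ j) (h t : ℝ) (x : Fin n → ℝ) :
    shiftDir i h (update x j t) = update (shiftDir i h x) j t := by
  simp [shiftDir, update_of_ne hij, update_comm hij]

lemma rearrIooDir_update (a : Fin n → ℝ) (i : Fin n) (g : (Fin n → ℝ) → ℝ) (x : Fin n → ℝ)
    (t : ℝ) :
    rearrIooDir a i g (update x i t) = rearrIoo (a i) (fun s => g (update x i s)) t := by
  simp [rearrIooDir]

variable {a : Fin n → ℝ} {g : (Fin n → ℝ) → ℝ} {M : ℝ}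

lemma measurable_comp_update (hg : Measurable g) (x : Fin n → ℝ) (i : Fin n) :
    Measurable fun t => g (update x i t) :=
  hg.comp (measurable_update x)

lemma measurable_rearrIooDir (hg : Measurable g) (hb : ∀ x, |g x| ≤ M) (i : Fin n) :
    Measurable (rearrIooDir a i g) := by
  refine measurable_of_Iic fun c => ?_
  have hlev : Measurable fun x : Fin n → ℝ => ivol (a i) {t | g (update x i t) ≤ c} :=
    measurable_measure_prodMk_left (ν := ivol (a i))
      (s := {p : (Fin n → ℝ) × ℝ | g (update p.1 i p.2) ≤ c})
      (measurableSet_le (hg.comp measurable_update') measurable_const)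
  have hcoord : MeasurableSet {x : Fin n → ℝ | x i ∈ Ioo 0 (a i)} :=
    measurable_pi_apply i measurableSet_Ioo
  have : rearrIooDir a i g ⁻¹' Iic c =
      ({x | x i ∈ Ioo 0 (a i)} ∩
        {x | ENNReal.ofReal (x i) ≤ ivol (a i) {t | g (update x i t) ≤ c}}) ∪
      ({x | x i ∈ Ioo 0 (a i)}ᶜ ∩ {_x | 0 ≤ c}) := by
    ext x
    by_cases hx : x i ∈ Ioo 0 (a i)
    · simp only [mem_preimage, mem_Iic, rearrIooDir,
        rearrIoo_le_iff (measurable_comp_update hg x i) (fun t => hb _) hx]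
      simp only [mem_union, mem_inter_iff, mem_compl_iff, mem_ofPred_eq, hx]
      tauto
    · simp only [mem_preimage, mem_Iic, rearrIooDir, rearrIoo, hx]
      simp only [mem_union, mem_inter_iff, mem_compl_iff, mem_ofPred_eq, hx]
      simp
  rw [this]
  exact (hcoord.inter (measurableSet_le (measurable_pi_apply i).ennreal_ofReal hlev)).union
    (hcoord.compl.inter (MeasurableSet.const _))

lemma abs_rearrIooDir_le (hg : Measurable g) (hb : ∀ x, |g x| ≤ M) (i : Fin n) (x : Fin n → ℝ) :
    |rearrIooDir a i g x| ≤ M :=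
  abs_rearrIoo_le (measurable_comp_update hg x i) (fun _ => hb _) _

lemma lipschitz_rearrIooDir {K : NNReal} {i j : Fin n} (hij : i ≠ j) (hg : Measurable g)
    (hb : ∀ x, |g x| ≤ M) (hL : ∀ x, LipschitzWith K fun t => g (update x i t))
    (x : Fin n → ℝ) : LipschitzWith K fun t => rearrIooDir a j g (update x i t) := by
  refine LipschitzWith.of_le_add_mul K fun s t => ?_
  simp only [rearrIooDir, update_of_ne hij.symm]
  refine rearrIoo_le_add (measurable_comp_update hg _ j) (fun _ => hb _)
    (measurable_comp_update hg _ j) (fun _ => hb _) (by positivity) (fun y => ?_) _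
  rw [update_comm hij, update_comm hij]
  exact (hL (update x j y)).le_add_mul s t

lemma decrement_rearrIooDir_le {h : ℝ} {i j : Fin n} (hij : i ≠ j) (hg : Measurable g)
    (hb : ∀ x, |g x| ≤ M) : decrement a h i (rearrIooDir a j g) ≤ decrement a h i g := by
  have hR := measurable_rearrIooDir (a := a) hg hb j
  refine lintegral_le_of_lmarginal_le {j}
    (hR.fun_sub (hR.comp (measurable_shiftDir i h))).ennreal_ofReal
    (hg.fun_sub (hg.comp (measurable_shiftDir i h))).ennreal_ofReal ?_
  rw [lmarginal_singleton, lmarginal_singleton]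
  intro x
  simp only [shiftDir_update_of_ne hij, rearrIooDir_update]
  exact lintegral_rearrIoo_sub_le (measurable_comp_update hg _ j) (fun _ => hb _)
    (measurable_comp_update hg _ j) (fun _ => hb _)

lemma lintegral_sub_rearrIooDir_le {h : ℝ} {K : NNReal} {i : Fin n} (ha : 0 < a i) (hh : 0 < h)
    (hg : Measurable g) (hb : ∀ x, |g x| ≤ M)
    (hL : ∀ x, LipschitzWith K fun t => g (update x i t)) :
    ∫⁻ x, ENNReal.ofReal |g x - rearrIooDir a i g x| ∂(boxVol a) ≤
      ENNReal.ofReal (2 * K * h) * boxVol a univ +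
        ENNReal.ofReal (a i / h) * decrement a h i g := by
  have hd : Measurable fun x => ENNReal.ofReal (g x - g (shiftDir i h x)) :=
    (hg.fun_sub (hg.comp (measurable_shiftDir i h))).ennreal_ofReal
  calc ∫⁻ x, ENNReal.ofReal |g x - rearrIooDir a i g x| ∂(boxVol a)
      ≤ ∫⁻ x, (ENNReal.ofReal (2 * K * h) +
          ENNReal.ofReal (a i / h) * ENNReal.ofReal (g x - g (shiftDir i h x))) ∂(boxVol a) := by
        refine lintegral_le_of_lmarginal_le {i}
          (hg.fun_sub (measurable_rearrIooDir hg hb i)).abs.ennreal_ofReal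
          (measurable_const.add (hd.const_mul _)) ?_
        rw [lmarginal_singleton, lmarginal_singleton]
        intro x
        simp only [rearrIooDir_update, shiftDir_update_self]
        exact lintegral_sub_rearrIoo_le ha (hL x) (fun _ => hb _) hh
    _ = _ := by
        rw [lintegral_add_left measurable_const, lintegral_const, lintegral_const_mul _ hd]
        rfl

lemma lintegral_sub_foldl_le {h : ℝ} {K : NNReal} (hh : 0 < h) (ha : ∀ i, 0 < a i)
    (C : Fin n → ℝ≥0∞) (l : List (Fin n)) (hl : l.Nodup) (g : (Fin n → ℝ) → ℝ) (hg : Measurable g)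
    (hb : ∀ x, |g x| ≤ M) (hL : ∀ i ∈ l, ∀ x, LipschitzWith K fun t => g (update x i t))
    (hC : ∀ i ∈ l, decrement a h i g ≤ C i) :
    Measurable (l.foldl (fun g i => rearrIooDir a i g) g) ∧
    ∫⁻ x, ENNReal.ofReal |g x - l.foldl (fun g i => rearrIooDir a i g) g x| ∂(boxVol a) ≤
      (l.map fun i => ENNReal.ofReal (2 * K * h) * boxVol a univ +
        ENNReal.ofReal (a i / h) * C i).sum := by
  induction l generalizing g with
  | nil => simpa using hg
  | cons i l ih =>
    rw [List.nodup_cons] at hl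
    have hne : ∀ j ∈ l, j ≠ i := fun j hj hji => hl.1 (hji ▸ hj)
    have hR := measurable_rearrIooDir (a := a) hg hb i
    obtain ⟨hm, hle⟩ := ih hl.2 (rearrIooDir a i g) hR (abs_rearrIooDir_le hg hb i)
      (fun j hj => lipschitz_rearrIooDir (hne j hj) hg hb (hL j (List.mem_cons_of_mem _ hj)))
      (fun j hj => (decrement_rearrIooDir_le (hne j hj) hg hb).trans
        (hC j (List.mem_cons_of_mem _ hj)))
    refine ⟨hm, ?_⟩
    rw [List.map_cons, List.sum_cons, List.foldl_cons]
    refine le_trans ?_ (add_le_add ((lintegral_sub_rearrIooDir_le (ha i) hh hg hb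
      (hL i List.mem_cons_self)).trans (add_le_add_right
        (mul_le_mul_right (hC i List.mem_cons_self) _) _)) hle)
    rw [← lintegral_add_left (hg.fun_sub hR).abs.ennreal_ofReal]
    refine lintegral_mono fun x => ?_
    rw [← ENNReal.ofReal_add (abs_nonneg _) (abs_nonneg _)]
    exact ENNReal.ofReal_le_ofReal (abs_sub_le _ _ _)

lemma rearr1_eq_rearrIoo {m x : ℝ} {g g' : ℝ → ℝ} (h : ∀ y ∈ Ioo 0 m, g y = g' y)
    (hx : x ∈ Ioo 0 m) : rearr1 m g x = rearrIoo m g' x := by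
  rw [rearr1, rearrIoo, if_pos hx]
  congr 1
  ext c
  have hvol : volume (levelSet m g c) = ivol m {y | g' y ≤ c} := by
    have h1 : levelSet m g c = Icc 0 m ∩ {y | g y ≤ c} := rfl
    have h2 : Ioo 0 m ∩ {y | g y ≤ c} = Ioo 0 m ∩ {y | g' y ≤ c} := by
      ext y
      simp only [mem_inter_iff, mem_ofPred_eq]
      exact and_congr_right fun hy => by rw [h y hy]
    rw [Measure.restrict_apply' measurableSet_Ioo, inter_comm, ← h2, h1]
    exact measure_congr (Ioo_ae_eq_Icc.symm.inter (ae_eq_refl _))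
  simp only [mem_ofPred_eq, hvol]
  refine ⟨fun H => H.2.2, fun H => ⟨?_, hx.1.le, H⟩⟩
  refine nonempty_of_measure_ne_zero (μ := volume) ?_
  rw [hvol]
  exact ((ENNReal.ofReal_pos.2 hx.1).trans_le H).ne'

lemma foldl_rearrDir_eq (l : List (Fin n)) (g g' : (Fin n → ℝ) → ℝ)
    (h : ∀ x, (∀ i, x i ∈ Ioo 0 (a i)) → g x = g' x) (x : Fin n → ℝ)
    (hx : ∀ i, x i ∈ Ioo 0 (a i)) :
    l.foldl (fun g i => rearrDir a i g) g x = l.foldl (fun g i => rearrIooDir a i g) g' x := by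
  induction l generalizing g g' with
  | nil => exact h x hx
  | cons j l ih =>
    refine ih _ _ fun y hy => rearr1_eq_rearrIoo (fun t ht => h _ fun i => ?_) (hy j)
    rcases eq_or_ne i j with rfl | hij
    · simpa using ht
    · simpa [update_of_ne hij] using hy i

/-- The coordinatewise projection onto the closed box. -/
noncomputable def clampBox (a : Fin n → ℝ) (x : Fin n → ℝ) : Fin n → ℝ :=
  fun i => max 0 (min (a i) (x i))

lemma clampBox_mem (ha : ∀ i, 0 < a i) (x : Fin n → ℝ) : clampBox a x ∈ Icc 0 a :=
  ⟨fun _ => le_max_left _ _, fun i => max_le (ha i).le (min_le_left _ _)⟩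

lemma clampBox_of_mem {x : Fin n → ℝ} (hx : ∀ i, x i ∈ Ioo 0 (a i)) : clampBox a x = x := by
  ext i
  rw [clampBox, min_eq_right (hx i).2.le, max_eq_right (hx i).1.le]

lemma lipschitz_clampBox (a : Fin n → ℝ) : LipschitzWith 1 (clampBox a) := by
  refine LipschitzWith.of_dist_le_mul fun x y => ?_
  rw [NNReal.coe_one, one_mul, dist_pi_le_iff dist_nonneg]
  intro i
  refine le_trans ?_ (dist_le_pi_dist x y i)
  rw [Real.dist_eq, Real.dist_eq, clampBox, clampBox]
  refine (abs_max_sub_max_le_max _ _ _ _).trans ?_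
  rw [sub_self, abs_zero]
  refine max_le (abs_nonneg _) ((abs_min_sub_min_le_max _ _ _ _).trans ?_)
  simp

lemma lipschitz_comp_update {K : NNReal} (hg : LipschitzWith K g) (x : Fin n → ℝ) (i : Fin n) :
    LipschitzWith K fun t => g (update x i t) := by
  have : LipschitzWith 1 (update x i) := by
    refine LipschitzWith.of_dist_le_mul fun s t => ?_
    rw [NNReal.coe_one, one_mul, dist_pi_le_iff dist_nonneg]
    intro j
    rcases eq_or_ne j i with rfl | hij
    · simp
    · simp [update_of_ne hij]
  simpa [comp_def] using hg.comp this

lemma measurable_pdiff {K : NNReal} (hg : LipschitzWith K g) (i : Fin n) :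
    Measurable (pdiff i g) := by
  have hc : Continuous (uncurry fun (x : Fin n → ℝ) (t : ℝ) => g (update x i t)) :=
    hg.continuous.comp (continuous_update i)
  exact (measurable_deriv_with_param hc).comp (measurable_id.prodMk (measurable_pi_apply i))

lemma pdiff_update (i : Fin n) (g : (Fin n → ℝ) → ℝ) (x : Fin n → ℝ) (t : ℝ) :
    pdiff i g (update x i t) = deriv (fun s => g (update x i s)) t := by
  simp [pdiff]

lemma decrement_le {K : NNReal} {h : ℝ} {i : Fin n} (hg : LipschitzWith K g) (hh : 0 < h)
    (hc : ∀ x t, a i ≤ t → g (update x i t) = g (update x i (a i))) :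
    decrement a h i g ≤
      ENNReal.ofReal h * ∫⁻ x, ENNReal.ofReal |min 0 (pdiff i g x)| ∂(boxVol a) := by
  have hgm := hg.continuous.measurable
  have hp : Measurable fun x => ENNReal.ofReal |min 0 (pdiff i g x)| :=
    (measurable_const.min (measurable_pdiff hg i)).abs.ennreal_ofReal
  rw [← lintegral_const_mul _ hp]
  refine lintegral_le_of_lmarginal_le {i}
    (hgm.fun_sub (hgm.comp (measurable_shiftDir i h))).ennreal_ofReal (hp.const_mul _) ?_
  rw [lmarginal_singleton, lmarginal_singleton]
  intro x
  simp only [shiftDir_update_self, pdiff_update]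
  rw [lintegral_const_mul _ (((measurable_const.min (measurable_deriv _)).abs).ennreal_ofReal)]
  exact lintegral_sub_shift_le (lipschitz_comp_update hg x i) hh (hc x)

lemma abs_min_zero_pdiff_le {K : NNReal} (hg : LipschitzWith K g) (i : Fin n) (x : Fin n → ℝ) :
    |min 0 (pdiff i g x)| ≤ K := by
  have h1 := abs_le.1
    (norm_deriv_le_of_lipschitz (x₀ := x i) (lipschitz_comp_update hg x i))
  rw [abs_le]
  exact ⟨le_min (by simp) h1.1, (min_le_left _ _).trans K.coe_nonneg⟩

lemma boxVol_eq (a : Fin n → ℝ) : boxVol a = volume.restrict (Icc 0 a) := by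
  rw [boxVol, ← Measure.restrict_pi_pi]
  exact Measure.restrict_congr_set Measure.univ_pi_Ioo_ae_eq_Icc

lemma ae_boxVol_mem (a : Fin n → ℝ) : ∀ᵐ x ∂(boxVol a), ∀ i, x i ∈ Ioo 0 (a i) := by
  rw [boxVol, ← Measure.restrict_pi_pi]
  filter_upwards [ae_restrict_mem (MeasurableSet.univ_pi fun i => measurableSet_Ioo)] with x hx i
  exact hx i (mem_univ i)

lemma pdiff_congr {f g : (Fin n → ℝ) → ℝ} (h : ∀ x, (∀ i, x i ∈ Ioo 0 (a i)) → f x = g x)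
    (i : Fin n) {x : Fin n → ℝ} (hx : ∀ i, x i ∈ Ioo 0 (a i)) : pdiff i f x = pdiff i g x := by
  refine Filter.EventuallyEq.deriv_eq ?_
  filter_upwards [Ioo_mem_nhds (hx i).1 (hx i).2] with t ht
  refine h _ fun j => ?_
  rcases eq_or_ne j i with rfl | hij
  · simpa using ht
  · simpa [update_of_ne hij] using hx j

/-- The inequality with constant one for a globally Lipschitz function which is constant beyond
the upper faces of the box. -/
lemma integral_sub_foldl_le {K : NNReal} (ha : ∀ i, 0 < a i) (hg : LipschitzWith K g)
    (hb : ∀ x, |g x| ≤ M)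
    (hc : ∀ i x t, a i ≤ t → g (update x i t) = g (update x i (a i))) :
    ∫ x, |g x - (List.finRange n).foldl (fun g i => rearrIooDir a i g) g x| ∂(boxVol a) ≤
      ∑ i, a i * ∫ x, |min 0 (pdiff i g x)| ∂(boxVol a) := by
  set R := (List.finRange n).foldl (fun g i => rearrIooDir a i g) g with hR
  set P : Fin n → ℝ := fun i => ∫ x, |min 0 (pdiff i g x)| ∂(boxVol a) with hP
  have hP0 : ∀ i, 0 ≤ P i := fun i => integral_nonneg fun x => abs_nonneg _
  have hPl : ∀ i, ∫⁻ x, ENNReal.ofReal |min 0 (pdiff i g x)| ∂(boxVol a) =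
      ENNReal.ofReal (P i) := by
    intro i
    refine (ofReal_integral_eq_lintegral_ofReal ?_ (ae_of_all _ fun x => abs_nonneg _)).symm
    refine Integrable.mono' (integrable_const (K : ℝ))
      (measurable_const.min (measurable_pdiff hg i)).abs.aestronglyMeasurable
      (ae_of_all _ fun x => ?_)
    simpa using abs_min_zero_pdiff_le hg i x
  set V : ℝ := (boxVol a univ).toReal with hV
  have hVl : boxVol a univ = ENNReal.ofReal V := (ENNReal.ofReal_toReal (measure_ne_top _ _)).symm
  have main : ∀ h > 0, ∫ x, |g x - R x| ∂(boxVol a) ≤ ∑ i, (2 * K * h * V + a i * P i) := by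
    intro h hh
    obtain ⟨hm, hle⟩ := lintegral_sub_foldl_le (a := a) (K := K) hh ha
      (fun i => ENNReal.ofReal h * ENNReal.ofReal (P i)) (List.finRange n) (List.nodup_finRange n)
      g hg.continuous.measurable hb (fun i _ x => lipschitz_comp_update hg x i)
      (fun i _ => (decrement_le hg hh (hc i)).trans_eq (by rw [hPl]))
    rw [← hR] at hm hle
    rw [integral_eq_lintegral_of_nonneg_ae (ae_of_all _ fun x => abs_nonneg _)
      (hg.continuous.measurable.fun_sub hm).abs.aestronglyMeasurable]
    refine ENNReal.toReal_le_of_le_ofReal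
      (Finset.sum_nonneg fun i _ => by have := (ha i).le; have := hP0 i; positivity) ?_
    refine hle.trans_eq ?_
    rw [ENNReal.ofReal_sum_of_nonneg
      (fun i _ => by have := (ha i).le; have := hP0 i; positivity), ← List.ofFn_eq_map,
      List.sum_ofFn]
    refine Finset.sum_congr rfl fun i _ => ?_
    have hai := ha i
    have hPi := hP0 i
    rw [hVl, ← ENNReal.ofReal_mul (by positivity), ← ENNReal.ofReal_mul (by positivity),
      ← ENNReal.ofReal_mul (by positivity), ← ENNReal.ofReal_add (by positivity) (by positivity)]
    congr 1
    field_simp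
  have hlim : Tendsto (fun h : ℝ => ∑ i, (2 * K * h * V + a i * P i)) (𝓝[>] 0)
      (𝓝 (∑ i, (2 * K * 0 * V + a i * P i))) := by
    refine Tendsto.mono_left (Continuous.tendsto ?_ 0) nhdsWithin_le_nhds
    fun_prop
  simpa using ge_of_tendsto hlim (eventually_mem_nhdsWithin.mono main)

end Box

/-- **Directed `(L¹, ℓ¹)`-Poincaré inequality on a box:** for Lipschitz `f` on the box
`[0,a₁] × ⋯ × [0,aₙ]` with monotone rearrangement `f* = Rₙ ⋯ R₁ f`,
`∫_B |f − f*| dν ≤ 2 Σᵢ aᵢ ∫_B |∂⁻ᵢ f| dν`. -/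
theorem directed_poincare_box {n : ℕ} (a : Fin n → ℝ) (ha : ∀ i, 0 < a i) (K : NNReal)
    (f : (Fin n → ℝ) → ℝ) (hf : LipschitzOnWith K f (Set.Icc 0 a)) :
    (∫ x in Set.Icc (0 : Fin n → ℝ) a, |f x - monoRearr a f x|) ≤
      2 * ∑ i, a i * ∫ x in Set.Icc (0 : Fin n → ℝ) a, |min 0 (pdiff i f x)| := by
  have hclamp := fun x => clampBox_mem ha x
  set g : (Fin n → ℝ) → ℝ := fun x => f (clampBox a x) with hgdef
  have hg : LipschitzWith K g := by
    simpa [g, Function.comp_def] using lipschitzOnWith_univ.1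
      (hf.comp (lipschitz_clampBox a).lipschitzOnWith fun x _ => hclamp x)
  have hfg : ∀ x, (∀ i, x i ∈ Ioo 0 (a i)) → f x = g x := fun x hx => by
    simp only [hgdef]
    rw [clampBox_of_mem hx]
  obtain ⟨M, hM⟩ := isCompact_Icc.exists_bound_of_continuousOn hf.continuousOn
  have key := integral_sub_foldl_le ha hg (fun x => hM _ (hclamp x)) fun i x t ht => by
    simp only [hgdef]
    congr 1
    ext j
    rcases eq_or_ne j i with rfl | hij
    · simp [clampBox, ht]
    · simp [clampBox, Function.update_of_ne hij]
  rw [← boxVol_eq]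
  have hL : ∫ x, |f x - monoRearr a f x| ∂(boxVol a) =
      ∫ x, |g x - (List.finRange n).foldl (fun g i => rearrIooDir a i g) g x| ∂(boxVol a) := by
    refine integral_congr_ae ?_
    filter_upwards [ae_boxVol_mem a] with x hx
    rw [hfg x hx, monoRearr, foldl_rearrDir_eq _ f g hfg x hx]
  have hD : ∀ i, ∫ x, |min 0 (pdiff i f x)| ∂(boxVol a) =
      ∫ x, |min 0 (pdiff i g x)| ∂(boxVol a) := by
    intro i
    refine integral_congr_ae ?_
    filter_upwards [ae_boxVol_mem a] with x hx
    rw [pdiff_congr hfg i hx]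
  simp only [hL, hD]
  have h0 : 0 ≤ ∑ i, a i * ∫ x, |min 0 (pdiff i g x)| ∂(boxVol a) :=
    Finset.sum_nonneg fun i _ => mul_nonneg (ha i).le (integral_nonneg fun x => abs_nonneg _)
  linarith
end

section
/- Let f : [0,1]^n → ℝ be Lipschitz with |f(x) − f(y)| ≤ L·‖x − y‖₁ for all x, y, and suppose d₁(f) > ε, where d₁(f) is the L¹ distance from f to the set of monotone functions under the uniform (Lebesgue) measure. For each i ∈ [n] let S_i := {x ∈ [0,1]^n : f is differentiable at x and ∂_i f(x) < 0}. Then Σ_{i=1}^n ν(S_i) > ε/(2L), where ν is the Lebesgue measure. -/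
open MeasureTheory

section Rearrangement

variable {m : ℕ}

/-- The nondecreasing rearrangement of a tuple. -/
noncomputable def sortTuple (f : Fin m → ℝ) : Fin m → ℝ := f ∘ Tuple.sort f

lemma monotone_sortTuple (f : Fin m → ℝ) : Monotone (sortTuple f) := Tuple.monotone_sort f

lemma sum_sortTuple (f : Fin m → ℝ) : ∑ t, sortTuple f t = ∑ t, f t :=
  Equiv.sum_comp (Tuple.sort f) f

lemma sortTuple_eq_self {f : Fin m → ℝ} (hf : Monotone f) : sortTuple f = f := by
  simp [sortTuple, Tuple.sort_eq_refl_iff_monotone.mpr hf]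

lemma sortTuple_le_sortTuple {f g : Fin m → ℝ} (h : f ≤ g) : sortTuple f ≤ sortTuple g := by
  intro k
  by_contra! hlt
  have hcard : (Finset.univ : Finset (Fin m)).card <
      ((Finset.Iic k).map (Tuple.sort g).toEmbedding).card +
        ((Finset.Ici k).map (Tuple.sort f).toEmbedding).card := by
    simp only [Finset.card_map, Fin.card_Iic, Fin.card_Ici, Finset.card_univ, Fintype.card_fin]
    omega
  obtain ⟨x, hx⟩ := Finset.inter_nonempty_of_card_lt_card_add_card
    (Finset.subset_univ _) (Finset.subset_univ _) hcard
  simp only [Finset.mem_inter, Finset.mem_map, Finset.mem_Iic, Finset.mem_Ici,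
    Equiv.coe_toEmbedding] at hx
  obtain ⟨⟨i, hi, hix⟩, j, hj, hjx⟩ := hx
  have h1 : g x ≤ sortTuple g k := hix ▸ monotone_sortTuple g hi
  have h2 : sortTuple f k ≤ f x := hjx ▸ monotone_sortTuple f hj
  linarith [h x]

/-- Rearrangement does not increase the total positive part of a difference. -/
lemma sum_sortTuple_sub_max_le (f g : Fin m → ℝ) :
    ∑ t, max (sortTuple f t - sortTuple g t) 0 ≤ ∑ t, max (f t - g t) 0 := by
  have hf := sortTuple_le_sortTuple (le_sup_left : f ≤ f ⊔ g)
  have hg := sortTuple_le_sortTuple (le_sup_right : g ≤ f ⊔ g)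
  calc ∑ t, max (sortTuple f t - sortTuple g t) 0
      ≤ ∑ t, (sortTuple (f ⊔ g) t - sortTuple g t) := by
        refine Finset.sum_le_sum fun t _ => max_le ?_ ?_
        · linarith [hf t]
        · linarith [hg t]
    _ = ∑ t, max (f t - g t) 0 := by
        rw [Finset.sum_sub_distrib, sum_sortTuple, sum_sortTuple, ← Finset.sum_sub_distrib]
        refine Finset.sum_congr rfl fun t _ => ?_
        rw [Pi.sup_apply, ← max_sub_sub_right, sub_self]

/-- Rearrangement moves each entry by at most the total descent of the tuple. -/
lemma abs_sub_sortTuple_le (f : Fin m → ℝ) (t : Fin m) :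
    |f t - sortTuple f t| ≤ ∑ s, max (f s - f (Order.succ s)) 0 := by
  set A := ∑ s, max (f s - f (Order.succ s)) 0 with hA
  set P : Fin m → ℝ := fun t => ∑ s ∈ Finset.Iio t, max (f s - f (Order.succ s)) 0 with hP
  have hP0 : ∀ t, 0 ≤ P t := fun t => Finset.sum_nonneg fun _ _ => le_max_right _ _
  have hPA : ∀ t, P t ≤ A := fun t =>
    Finset.sum_le_univ_sum_of_nonneg fun _ => le_max_right _ _
  have hmono : Monotone (f + P) := by
    refine monotone_of_le_succ fun a ha => ?_
    have : P (Order.succ a) = max (f a - f (Order.succ a)) 0 + P a := by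
      simp only [hP]
      rw [Finset.Iio_succ_eq_Iic_of_not_isMax ha, ← Finset.Iio_insert,
        Finset.sum_insert (by simp)]
    simp only [Pi.add_apply, this]
    linarith [le_max_left (f a - f (Order.succ a)) 0]
  have hup : sortTuple f ≤ f + P := by
    rw [← sortTuple_eq_self hmono]
    exact sortTuple_le_sortTuple fun t => by simp [hP0 t]
  have hlow : (fun t => f t + P t - A) ≤ sortTuple f := by
    have hm : Monotone fun t => f t + P t - A := fun a b hab => by
      have := hmono hab
      simp only [Pi.add_apply] at this
      linarith
    rw [← sortTuple_eq_self hm]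
    exact sortTuple_le_sortTuple fun t => by dsimp only; linarith [hPA t]
  have h1 := hup t
  have h2 := hlow t
  simp only [Pi.add_apply] at h1 h2
  rw [abs_le]
  constructor <;> linarith [hPA t, hP0 t]

end Rearrangement

section Grid

variable {ι : Type*} [DecidableEq ι] {m : ℕ}

/-- The neighbour of a grid point in direction `i`; a point on the last face is fixed. -/
def gridSucc (i : ι) (x : ι → Fin m) : ι → Fin m := Function.update x i (Order.succ (x i))

/-- Rearrangement of a function on the grid along all lines in direction `i`. -/
noncomputable def gridSort (i : ι) (F : (ι → Fin m) → ℝ) : (ι → Fin m) → ℝ :=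
  fun x => sortTuple (fun t => F (Function.update x i t)) (x i)

lemma gridSort_update (i : ι) (F : (ι → Fin m) → ℝ) (x : ι → Fin m) (t : Fin m) :
    gridSort i F (Function.update x i t) = sortTuple (fun s => F (Function.update x i s)) t := by
  simp [gridSort]

lemma gridSucc_update_self (i : ι) (x : ι → Fin m) (t : Fin m) :
    gridSucc i (Function.update x i t) = Function.update x i (Order.succ t) := by
  simp [gridSucc]

lemma gridSucc_update_of_ne {i j : ι} (h : j ≠ i) (x : ι → Fin m) (t : Fin m) :
    gridSucc j (Function.update x i t) = Function.update (gridSucc j x) i t := by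
  simp [gridSucc, Function.update_of_ne h, Function.update_comm h]

variable [Fintype ι]

/-- The total descent of a function on the grid in direction `i`. -/
def gridDescent (i : ι) (F : (ι → Fin m) → ℝ) : ℝ := ∑ x, max (F x - F (gridSucc i x)) 0

lemma gridDescent_nonneg (i : ι) (F : (ι → Fin m) → ℝ) : 0 ≤ gridDescent i F :=
  Finset.sum_nonneg fun _ _ => le_max_right _ _

lemma sum_sum_update (i : ι) (H : (ι → Fin m) → ℝ) :
    ∑ x, ∑ t, H (Function.update x i t) = m * ∑ x, H x := by
  let e : (ι → Fin m) × Fin m ≃ (ι → Fin m) × Fin m :=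
    Function.Involutive.toPerm (fun p => (Function.update p.1 i p.2, p.1 i))
      (fun p => by simp)
  rw [← Fintype.sum_prod_type' fun x t => H (Function.update x i t)]
  have := Equiv.sum_comp e fun p => H p.1
  rw [Fintype.sum_prod_type (fun p : (ι → Fin m) × Fin m => H p.1)] at this
  simp only [Finset.sum_const, Finset.card_univ, Fintype.card_fin, nsmul_eq_mul,
    ← Finset.mul_sum] at this
  exact this

lemma sum_le_sum_of_lines (i : ι) {H K : (ι → Fin m) → ℝ}
    (h : ∀ x, ∑ t, H (Function.update x i t) ≤ ∑ t, K (Function.update x i t)) :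
    ∑ x, H x ≤ ∑ x, K x := by
  rcases Nat.eq_zero_or_pos m with rfl | hm
  · have : IsEmpty (ι → Fin 0) := ⟨fun x => (x i).elim0⟩
    simp
  · have := Finset.sum_le_sum fun x (_ : x ∈ Finset.univ) => h x
    rw [sum_sum_update, sum_sum_update] at this
    exact le_of_mul_le_mul_left this (by exact_mod_cast hm)

lemma gridDescent_gridSort_self (i : ι) (F : (ι → Fin m) → ℝ) :
    gridDescent i (gridSort i F) = 0 := by
  refine le_antisymm ?_ (gridDescent_nonneg _ _)
  refine Finset.sum_nonpos fun x _ => max_le ?_ le_rfl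
  have h1 := gridSort_update i F x (x i)
  rw [Function.update_eq_self] at h1
  rw [h1, gridSucc, gridSort_update, sub_nonpos]
  exact monotone_sortTuple _ (Order.le_succ _)

lemma gridDescent_gridSort_le (i j : ι) (F : (ι → Fin m) → ℝ) :
    gridDescent j (gridSort i F) ≤ gridDescent j F := by
  rcases eq_or_ne j i with rfl | hne
  · rw [gridDescent_gridSort_self]
    exact gridDescent_nonneg _ _
  · refine sum_le_sum_of_lines i fun x => ?_
    simp only [gridSucc_update_of_ne hne, gridSort_update]
    exact sum_sortTuple_sub_max_le _ _

lemma sum_abs_sub_gridSort_le (i : ι) (F : (ι → Fin m) → ℝ) :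
    ∑ x, |F x - gridSort i F x| ≤ m * gridDescent i F := by
  rw [gridDescent, Finset.mul_sum]
  refine sum_le_sum_of_lines i fun x => ?_
  simp only [gridSucc_update_self, gridSort_update]
  calc _ ≤ ∑ _t : Fin m, ∑ s, max (F (Function.update x i s) -
          F (Function.update x i (Order.succ s))) 0 :=
        Finset.sum_le_sum fun t _ => abs_sub_sortTuple_le (fun s => F (Function.update x i s)) t
    _ = _ := by simp [Finset.mul_sum]

lemma le_gridSucc_of_gridDescent_eq_zero {i : ι} {F : (ι → Fin m) → ℝ}
    (h : gridDescent i F = 0) (x : ι → Fin m) : F x ≤ F (gridSucc i x) := by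
  have := (Finset.sum_eq_zero_iff_of_nonneg fun _ _ => le_max_right _ _).mp h x
    (Finset.mem_univ x)
  linarith [le_max_left (F x - F (gridSucc i x)) 0]

lemma monotone_of_gridDescent_eq_zero {F : (ι → Fin m) → ℝ} (h : ∀ i, gridDescent i F = 0) :
    Monotone F := by
  have hline : ∀ i x, Monotone fun t => F (Function.update x i t) := fun i x =>
    monotone_of_le_succ fun a _ => by
      have := le_gridSucc_of_gridDescent_eq_zero (h i) (Function.update x i a)
      rwa [gridSucc_update_self] at this
  intro x y hxy
  have key : ∀ s : Finset ι, F x ≤ F (s.piecewise y x) := by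
    intro s
    induction s using Finset.induction_on with
    | empty => simp
    | insert i s hi ih =>
      rw [Finset.piecewise_insert]
      refine ih.trans ?_
      have := hline i (s.piecewise y x) (hxy i)
      simpa [← Finset.piecewise_eq_of_notMem s y x hi] using this
  simpa using key Finset.univ

/-- A function on the grid is close in `ℓ¹` to a monotone one when its total descent is small. -/
lemma exists_monotone_sum_abs_sub_le (F : (ι → Fin m) → ℝ) :
    ∃ G : (ι → Fin m) → ℝ, Monotone G ∧
      ∑ x, |F x - G x| ≤ m * ∑ i, gridDescent i F := by
  have key : ∀ s : Finset ι, ∃ G : (ι → Fin m) → ℝ, (∀ i ∈ s, gridDescent i G = 0) ∧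
      (∀ i, gridDescent i G ≤ gridDescent i F) ∧
      ∑ x, |F x - G x| ≤ m * ∑ i ∈ s, gridDescent i F := by
    intro s
    induction s using Finset.induction_on with
    | empty => exact ⟨F, by simp⟩
    | insert i s hi ih =>
      obtain ⟨G, h0, hle, hsum⟩ := ih
      refine ⟨gridSort i G, fun j hj => ?_,
        fun j => (gridDescent_gridSort_le i j G).trans (hle j), ?_⟩
      · rcases Finset.mem_insert.mp hj with rfl | hj
        · exact gridDescent_gridSort_self _ _
        · exact le_antisymm ((gridDescent_gridSort_le i j G).trans_eq (h0 j hj))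
            (gridDescent_nonneg _ _)
      · rw [Finset.sum_insert hi, mul_add]
        calc ∑ x, |F x - gridSort i G x|
            ≤ ∑ x, (|G x - gridSort i G x| + |F x - G x|) :=
              Finset.sum_le_sum fun x _ => by
                rw [add_comm]; exact abs_sub_le _ _ _
          _ ≤ _ := by
              rw [Finset.sum_add_distrib]
              exact add_le_add ((sum_abs_sub_gridSort_le i G).trans
                (mul_le_mul_of_nonneg_left (hle i) (Nat.cast_nonneg m))) hsum
  obtain ⟨G, h0, -, hsum⟩ := key Finset.univ
  exact ⟨G, monotone_of_gridDescent_eq_zero fun i => h0 i (Finset.mem_univ i), hsum⟩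

end Grid

section Cells

variable {ι : Type*}

/-- The index of the cell of side `1 / (k + 1)` that contains a point of the unit cube. -/
noncomputable def gridCell (k : ℕ) (y : ι → ℝ) : ι → Fin (k + 1) :=
  fun i => ⟨min ⌊(k + 1 : ℝ) * y i⌋₊ k, Nat.lt_succ_of_le (min_le_right _ _)⟩

/-- The lowest corner of a cell of side `1 / (k + 1)`. -/
noncomputable def gridPoint {k : ℕ} (x : ι → Fin (k + 1)) : ι → ℝ :=
  fun i => (x i : ℝ) / (k + 1)

lemma monotone_gridCell (k : ℕ) : Monotone (gridCell k : (ι → ℝ) → ι → Fin (k + 1)) := by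
  intro x y h i
  rw [Fin.le_def]
  refine min_le_min_right k (Nat.floor_le_floor ?_)
  exact mul_le_mul_of_nonneg_left (h i) (by positivity)

lemma measurable_gridCell (k : ℕ) : Measurable (gridCell k : (ι → ℝ) → ι → Fin (k + 1)) := by
  refine measurable_pi_lambda _ fun i => ?_
  have h1 : Measurable fun j : ℕ =>
      (⟨min j k, Nat.lt_succ_of_le (min_le_right _ _)⟩ : Fin (k + 1)) :=
    measurable_from_top
  exact h1.comp (Nat.measurable_floor.comp (measurable_const.mul (measurable_pi_apply i)))

lemma gridPoint_mem_Icc {k : ℕ} (x : ι → Fin (k + 1)) : gridPoint x ∈ Set.Icc (0 : ι → ℝ) 1 := by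
  refine ⟨fun i => ?_, fun i => ?_⟩
  · simp only [gridPoint, Pi.zero_apply]; positivity
  · simp only [gridPoint, Pi.one_apply]
    rw [div_le_one (by positivity)]
    exact_mod_cast (x i).2.le

lemma gridCell_apply_bounds {k : ℕ} {y : ι → ℝ} {i : ι} (h0 : 0 ≤ y i) (h1 : y i ≤ 1) :
    (gridCell k y i : ℝ) ≤ (k + 1) * y i ∧ (k + 1) * y i ≤ gridCell k y i + 1 := by
  have hf := Nat.floor_le (show (0 : ℝ) ≤ (k + 1) * y i by positivity)
  have hl := Nat.lt_floor_add_one ((k + 1 : ℝ) * y i)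
  simp only [gridCell]
  rcases le_total ⌊(k + 1 : ℝ) * y i⌋₊ k with h | h
  · rw [min_eq_left h]
    exact ⟨hf, hl.le⟩
  · rw [min_eq_right h]
    have : (k : ℝ) ≤ ⌊(k + 1 : ℝ) * y i⌋₊ := by exact_mod_cast h
    constructor
    · linarith
    · nlinarith

lemma abs_sub_gridPoint_gridCell_le {k : ℕ} {y : ι → ℝ} (hy : y ∈ Set.Icc (0 : ι → ℝ) 1) (i : ι) :
    |y i - gridPoint (gridCell k y) i| ≤ 1 / (k + 1) := by
  obtain ⟨h1, h2⟩ := gridCell_apply_bounds (k := k) (hy.1 i) (hy.2 i)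
  have hk : (0 : ℝ) < k + 1 := by positivity
  have e : y i - gridPoint (gridCell k y) i = ((k + 1) * y i - gridCell k y i) / (k + 1) := by
    simp only [gridPoint]; field_simp
  rw [e, abs_of_nonneg (div_nonneg (by linarith) hk.le)]
  exact div_le_div_of_nonneg_right (by linarith) hk.le

lemma val_orderSucc_of_lt {k : ℕ} {a : Fin (k + 1)} (h : (a : ℕ) < k) :
    ((Order.succ a : Fin (k + 1)) : ℕ) = a + 1 := by
  obtain ⟨b, rfl⟩ := Fin.exists_castSucc_eq.mpr (show a ≠ Fin.last k from fun e => by simp [e] at h)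
  simp

lemma abs_gridPoint_gridSucc_sub_le [DecidableEq ι] {k : ℕ} (x : ι → Fin (k + 1)) (i j : ι) :
    |gridPoint x j - gridPoint (gridSucc i x) j| ≤ if j = i then (1 / (k + 1) : ℝ) else 0 := by
  split_ifs with h
  · subst h
    have hk : (0 : ℝ) < k + 1 := by positivity
    rcases Nat.lt_or_ge (x j) k with hlt | hge
    · simp only [gridPoint, gridSucc, Function.update_self, val_orderSucc_of_lt hlt]
      rw [← sub_div, abs_div, abs_of_pos hk]
      simp
    · have : x j = Fin.last k := Fin.ext (by have := (x j).2; simp; omega)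
      simp only [gridPoint, gridSucc, Function.update_self, this]
      simp
      positivity
  · simp [gridPoint, gridSucc, Function.update_of_ne h]

lemma gridPoint_gridSucc_of_lt [DecidableEq ι] {k : ℕ} {x : ι → Fin (k + 1)} {i : ι}
    (h : (x i : ℕ) < k) :
    gridPoint (gridSucc i x) = gridPoint x + (1 / (k + 1) : ℝ) • Pi.single i 1 := by
  ext j
  rcases eq_or_ne j i with rfl | hne
  · simp only [gridPoint, gridSucc, Function.update_self, val_orderSucc_of_lt h]
    simp [gridPoint, add_div]
  · simp [gridPoint, gridSucc, hne]

variable [Fintype ι]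

lemma volume_gridCell_preimage (k : ℕ) (x : ι → Fin (k + 1)) :
    volume (gridCell k ⁻¹' {x} ∩ Set.Icc (0 : ι → ℝ) 1) =
      ENNReal.ofReal (1 / (k + 1)) ^ Fintype.card ι := by
  have hk : (0 : ℝ) < k + 1 := by positivity
  have hset : gridCell k ⁻¹' {x} ∩ Set.Icc (0 : ι → ℝ) 1 =
      Set.univ.pi fun i => {t : ℝ | t ∈ Set.Icc 0 1 ∧ min ⌊(k + 1 : ℝ) * t⌋₊ k = x i} := by
    ext y
    simp only [Set.mem_inter_iff, Set.mem_preimage, Set.mem_singleton_iff, Set.mem_Icc,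
      Set.mem_pi, Set.mem_univ, forall_true_left, Set.mem_ofPred_eq, Pi.le_def, funext_iff,
      gridCell, Fin.ext_iff, Pi.zero_apply, Pi.one_apply]
    exact ⟨fun h i => ⟨⟨h.2.1 i, h.2.2 i⟩, h.1 i⟩,
      fun h => ⟨fun i => (h i).2, fun i => (h i).1.1, fun i => (h i).1.2⟩⟩
  have hvol : ∀ j : Fin (k + 1),
      volume {t : ℝ | t ∈ Set.Icc 0 1 ∧ min ⌊(k + 1 : ℝ) * t⌋₊ k = j} =
        ENNReal.ofReal (1 / (k + 1)) := by
    intro j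
    have hlen : ((j : ℝ) + 1) / (k + 1) - j / (k + 1) = 1 / (k + 1) := by ring
    apply le_antisymm
    · rw [← hlen, ← Real.volume_Icc]
      refine measure_mono fun t ht => ?_
      obtain ⟨⟨h0, h1⟩, hj⟩ := ht
      have := gridCell_apply_bounds (k := k) (y := fun _ : Unit => t) (i := ()) h0 h1
      simp only [gridCell, hj] at this
      rw [Set.mem_Icc, div_le_iff₀ hk, le_div_iff₀ hk]
      constructor <;> linarith
    · rw [← hlen, ← Real.volume_Ioo]
      refine measure_mono fun t ht => ?_
      rw [Set.mem_Ioo, div_lt_iff₀ hk, lt_div_iff₀ hk] at ht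
      have hj : (j : ℝ) + 1 ≤ k + 1 := by exact_mod_cast j.2
      have hj0 : (0 : ℝ) ≤ j := by positivity
      refine ⟨⟨?_, ?_⟩, ?_⟩
      · by_contra! hneg
        nlinarith
      · nlinarith
      · have : ⌊(k + 1 : ℝ) * t⌋₊ = j := by
          rw [Nat.floor_eq_iff (by linarith)]
          constructor <;> linarith
        rw [this]
        exact min_eq_left (Nat.lt_succ_iff.mp j.2)
  rw [hset, volume_pi_pi]
  simp_rw [hvol, Finset.prod_const, Finset.card_univ]

lemma integrableOn_comp_gridCell (k : ℕ) (H : (ι → Fin (k + 1)) → ℝ) :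
    IntegrableOn (fun y => H (gridCell k y)) (Set.Icc (0 : ι → ℝ) 1) := by
  have hfin : IsFiniteMeasure (volume.restrict (Set.Icc (0 : ι → ℝ) 1)) :=
    isFiniteMeasure_restrict.mpr isCompact_Icc.measure_ne_top
  have : Integrable H ((volume.restrict (Set.Icc (0 : ι → ℝ) 1)).map (gridCell k)) :=
    Integrable.of_finite
  exact this.comp_measurable (measurable_gridCell k)

variable [DecidableEq ι]

lemma integral_comp_gridCell (k : ℕ) (H : (ι → Fin (k + 1)) → ℝ) :
    ∫ y in Set.Icc (0 : ι → ℝ) 1, H (gridCell k y) =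
      (1 / (k + 1)) ^ Fintype.card ι * ∑ x, H x := by
  have hfin : IsFiniteMeasure (volume.restrict (Set.Icc (0 : ι → ℝ) 1)) :=
    isFiniteMeasure_restrict.mpr isCompact_Icc.measure_ne_top
  rw [← integral_map (measurable_gridCell k).aemeasurable
    (measurable_of_finite H).aestronglyMeasurable, integral_fintype Integrable.of_finite,
    Finset.mul_sum]
  refine Finset.sum_congr rfl fun x _ => ?_
  rw [measureReal_def, Measure.map_apply (measurable_gridCell k) (measurableSet_singleton x),
    Measure.restrict_apply (measurable_gridCell k (measurableSet_singleton x)),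
    volume_gridCell_preimage, ENNReal.toReal_pow,
    ENNReal.toReal_ofReal (by positivity), smul_eq_mul]

end Cells

section Lipschitz

open Filter Topology

variable {ι : Type*} [Fintype ι]

lemma lipschitzOnWith_of_abs_sub_le_mul_sum {L : ℝ} (hL : 0 ≤ L) {f : (ι → ℝ) → ℝ} {s : Set (ι → ℝ)}
    (hf : ∀ x ∈ s, ∀ y ∈ s, |f x - f y| ≤ L * ∑ i, |x i - y i|) :
    LipschitzOnWith (Real.toNNReal (L * Fintype.card ι)) f s := by
  rw [lipschitzOnWith_iff_dist_le_mul]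
  intro x hx y hy
  rw [Real.dist_eq, Real.coe_toNNReal _ (by positivity), mul_assoc]
  refine (hf x hx y hy).trans (mul_le_mul_of_nonneg_left ?_ hL)
  refine (Finset.sum_le_card_nsmul _ _ (dist x y) fun i _ => ?_).trans_eq (by simp)
  exact dist_le_pi_dist x y i

lemma ae_differentiableAt_of_lipschitzOn_Icc {f : (ι → ℝ) → ℝ} {C : NNReal}
    (hf : LipschitzOnWith C f (Set.Icc 0 1)) :
    ∀ᵐ y ∂volume.restrict (Set.Icc (0 : ι → ℝ) 1),
      y ∈ Set.Icc (0 : ι → ℝ) 1 ∧ (∀ i, y i < 1) ∧ DifferentiableAt ℝ f y := by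
  have hset : (Set.univ.pi fun _ : ι => Set.Ioo (0 : ℝ) 1) =ᵐ[volume] Set.Icc (0 : ι → ℝ) 1 :=
    Measure.univ_pi_Ioo_ae_eq_Icc
  have hopen : IsOpen (Set.univ.pi fun _ : ι => Set.Ioo (0 : ℝ) 1) :=
    isOpen_set_pi Set.finite_univ fun _ _ => isOpen_Ioo
  rw [← Measure.restrict_congr_set hset]
  filter_upwards [ae_restrict_mem hopen.measurableSet,
    ae_restrict_of_ae hf.ae_differentiableWithinAt_of_mem] with y hy hd
  have hsub : (Set.univ.pi fun _ : ι => Set.Ioo (0 : ℝ) 1) ⊆ Set.Icc (0 : ι → ℝ) 1 :=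
    fun z hz => ⟨fun i => (hz i trivial).1.le, fun i => (hz i trivial).2.le⟩
  exact ⟨hsub hy, fun i => (hy i trivial).2, (hd (hsub hy)).differentiableAt
    (Filter.mem_of_superset (hopen.mem_nhds hy) hsub)⟩

variable [DecidableEq ι]

/-- Difference quotients of `f` along the edges of the grid cells containing `y` converge to the
partial derivative of `f` at `y`. -/
lemma tendsto_gridCell_quotient {f : (ι → ℝ) → ℝ} {f' : (ι → ℝ) →L[ℝ] ℝ} {y : ι → ℝ}
    (hf : HasFDerivAt f f' y) (hy : y ∈ Set.Icc (0 : ι → ℝ) 1) {i : ι} (hi : y i < 1) :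
    Tendsto (fun k : ℕ => (k + 1 : ℝ) *
      (f (gridPoint (gridCell k y)) - f (gridPoint (gridSucc i (gridCell k y)))))
      atTop (𝓝 (-f' (Pi.single i 1))) := by
  have hinv : Tendsto (fun k : ℕ => (1 / (k + 1) : ℝ)) atTop (𝓝 0) :=
    tendsto_one_div_add_atTop_nhds_zero_nat
  have hnu : ∀ k : ℕ, ‖gridPoint (gridCell k y) - y‖ ≤ 1 / (k + 1) := fun k => by
    rw [pi_norm_le_iff_of_nonneg (by positivity)]
    intro j
    rw [Pi.sub_apply, Real.norm_eq_abs, abs_sub_comm]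
    exact abs_sub_gridPoint_gridCell_le hy j
  have hnv : ∀ k : ℕ, ‖gridPoint (gridSucc i (gridCell k y)) - y‖ ≤ 2 * (1 / (k + 1)) := fun k => by
    have h1 : ‖gridPoint (gridSucc i (gridCell k y)) - gridPoint (gridCell k y)‖ ≤
        1 / (k + 1) := by
      rw [pi_norm_le_iff_of_nonneg (by positivity)]
      intro j
      rw [Pi.sub_apply, Real.norm_eq_abs, abs_sub_comm]
      refine (abs_gridPoint_gridSucc_sub_le _ i j).trans ?_
      split_ifs
      · exact le_rfl
      · positivity
    have := norm_sub_le_norm_sub_add_norm_sub (gridPoint (gridSucc i (gridCell k y)))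
      (gridPoint (gridCell k y)) y
    linarith [hnu k]
  have hsmall : ∀ (C : ℝ) (u : ℕ → ι → ℝ), (∀ k : ℕ, ‖u k - y‖ ≤ C * (1 / (k + 1))) →
      (fun k => f (u k) - f y - f' (u k - y)) =o[atTop] fun k : ℕ => (1 / (k + 1) : ℝ) := by
    intro C u hu
    have hu0 : Tendsto u atTop (𝓝 y) := by
      rw [tendsto_iff_norm_sub_tendsto_zero]
      refine squeeze_zero (fun _ => norm_nonneg _) hu ?_
      simpa using hinv.const_mul C
    refine (hf.isLittleO.comp_tendsto hu0).trans_isBigO (Asymptotics.IsBigO.of_bound C ?_)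
    refine Eventually.of_forall fun k => ?_
    have : ‖(1 / (k + 1) : ℝ)‖ = 1 / (k + 1) := Real.norm_of_nonneg (by positivity)
    rw [this]
    exact hu k
  have hdiff := ((hsmall 1 _ fun k => by rw [one_mul]; exact hnu k).sub
    (hsmall 2 _ hnv)).tendsto_div_nhds_zero
  have hlt : ∀ᶠ k : ℕ in atTop, (gridCell k y i : ℕ) < k := by
    filter_upwards [hinv.eventually_lt_const (sub_pos.mpr hi)] with k hk
    rw [div_lt_iff₀ (by positivity)] at hk
    have := (gridCell_apply_bounds (k := k) (hy.1 i) (hy.2 i)).1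
    have : (gridCell k y i : ℝ) < k := by linarith
    exact_mod_cast this
  have := hdiff.sub_const (f' (Pi.single i 1))
  rw [zero_sub] at this
  refine this.congr' ?_
  filter_upwards [hlt] with k hk
  have hk1 : (k + 1 : ℝ) ≠ 0 := by positivity
  rw [gridPoint_gridSucc_of_lt hk]
  simp only [map_sub, map_add, map_smul, smul_eq_mul]
  field_simp
  ring

lemma abs_sub_gridSucc_le {L : ℝ} (hL : 0 ≤ L) {f : (ι → ℝ) → ℝ}
    (hf : ∀ x ∈ Set.Icc (0 : ι → ℝ) 1, ∀ y ∈ Set.Icc (0 : ι → ℝ) 1,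
      |f x - f y| ≤ L * ∑ i, |x i - y i|) {k : ℕ} (i : ι) (x : ι → Fin (k + 1)) :
    |f (gridPoint x) - f (gridPoint (gridSucc i x))| ≤ L * (1 / (k + 1)) := by
  refine (hf _ (gridPoint_mem_Icc _) _ (gridPoint_mem_Icc _)).trans
    (mul_le_mul_of_nonneg_left ?_ hL)
  refine (Finset.sum_le_sum fun j _ => abs_gridPoint_gridSucc_sub_le x i j).trans_eq ?_
  simp

/-- A monotone approximation whose `L¹` error is controlled by descents along a grid. -/
lemma exists_monotone_integral_abs_sub_le {L : ℝ} (hL : 0 ≤ L) {f : (ι → ℝ) → ℝ}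
    (hf : ∀ x ∈ Set.Icc (0 : ι → ℝ) 1, ∀ y ∈ Set.Icc (0 : ι → ℝ) 1,
      |f x - f y| ≤ L * ∑ i, |x i - y i|) (k : ℕ) :
    ∃ g : (ι → ℝ) → ℝ, Monotone g ∧ IntegrableOn g (Set.Icc 0 1) ∧
      ∫ y in Set.Icc (0 : ι → ℝ) 1, |f y - g y| ≤ L * Fintype.card ι * (1 / (k + 1)) +
        ∑ i, ∫ y in Set.Icc (0 : ι → ℝ) 1, max ((k + 1 : ℝ) * (f (gridPoint (gridCell k y)) -
          f (gridPoint (gridSucc i (gridCell k y))))) 0 := by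
  set F : (ι → Fin (k + 1)) → ℝ := fun x => f (gridPoint x) with hF
  obtain ⟨G, hG, hsum⟩ := exists_monotone_sum_abs_sub_le F
  have hfint : IntegrableOn f (Set.Icc 0 1) :=
    (lipschitzOnWith_of_abs_sub_le_mul_sum hL hf).continuousOn.integrableOn_compact isCompact_Icc
  have hGint := integrableOn_comp_gridCell k G
  have hFint := integrableOn_comp_gridCell k F
  have hvol : volume.real (Set.Icc (0 : ι → ℝ) 1) = 1 := by
    simp [measureReal_def, Real.volume_Icc_pi]
  refine ⟨fun y => G (gridCell k y), hG.comp (monotone_gridCell k), hGint, ?_⟩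
  have hnear : ∫ y in Set.Icc (0 : ι → ℝ) 1, |f y - F (gridCell k y)| ≤
      L * Fintype.card ι * (1 / (k + 1)) := by
    have hle : ∀ y ∈ Set.Icc (0 : ι → ℝ) 1, |f y - F (gridCell k y)| ≤
        L * Fintype.card ι * (1 / (k + 1)) := fun y hy => by
      refine (hf y hy _ (gridPoint_mem_Icc _)).trans ?_
      rw [mul_assoc]
      refine mul_le_mul_of_nonneg_left ?_ hL
      refine (Finset.sum_le_card_nsmul _ _ _ fun i _ =>
        abs_sub_gridPoint_gridCell_le hy i).trans_eq (by simp)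
    refine (setIntegral_mono_on (hfint.sub hFint).abs
      (integrableOn_const isCompact_Icc.measure_ne_top) measurableSet_Icc hle).trans_eq ?_
    rw [setIntegral_const, hvol, one_smul]
  have hfar : ∫ y in Set.Icc (0 : ι → ℝ) 1, |F (gridCell k y) - G (gridCell k y)| ≤
      ∑ i, ∫ y in Set.Icc (0 : ι → ℝ) 1, max ((k + 1 : ℝ) * (f (gridPoint (gridCell k y)) -
        f (gridPoint (gridSucc i (gridCell k y))))) 0 := by
    have hi : ∀ i, ∫ y in Set.Icc (0 : ι → ℝ) 1, max ((k + 1 : ℝ) *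
        (f (gridPoint (gridCell k y)) - f (gridPoint (gridSucc i (gridCell k y))))) 0 =
        (1 / (k + 1)) ^ Fintype.card ι * ((k + 1) * gridDescent i F) := fun i => by
      rw [integral_comp_gridCell k fun x => max ((k + 1 : ℝ) *
        (f (gridPoint x) - f (gridPoint (gridSucc i x)))) 0, gridDescent,
        Finset.mul_sum (a := (k + 1 : ℝ))]
      congr 1
      refine Finset.sum_congr rfl fun x _ => ?_
      rw [mul_max_of_nonneg _ _ (by positivity), mul_zero]
    simp_rw [hi]
    rw [integral_comp_gridCell k fun x => |F x - G x|, ← Finset.mul_sum, ← Finset.mul_sum]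
    refine mul_le_mul_of_nonneg_left ?_ (by positivity)
    exact_mod_cast hsum
  refine (integral_mono (hfint.sub hGint).abs
    ((hfint.sub hFint).abs.add (hFint.sub hGint).abs)
    fun y => abs_sub_le _ (F (gridCell k y)) _).trans ?_
  rw [integral_add' (hfint.sub hFint).abs (hFint.sub hGint).abs]
  exact add_le_add hnear hfar

/-- The limiting descent in direction `i` is at most `L` times the volume of the set where the
`i`-th partial derivative is negative. -/
lemma exists_tendsto_integral_quotient_le {L : ℝ} (hL : 0 ≤ L) {f : (ι → ℝ) → ℝ}
    (hf : ∀ x ∈ Set.Icc (0 : ι → ℝ) 1, ∀ y ∈ Set.Icc (0 : ι → ℝ) 1,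
      |f x - f y| ≤ L * ∑ i, |x i - y i|) (i : ι) :
    ∃ a ≤ L * (volume {x : ι → ℝ | x ∈ Set.Icc 0 1 ∧
        DifferentiableAt ℝ f x ∧ fderiv ℝ f x (Pi.single i 1) < 0}).toReal,
      Tendsto (fun k : ℕ => ∫ y in Set.Icc (0 : ι → ℝ) 1, max ((k + 1 : ℝ) *
        (f (gridPoint (gridCell k y)) - f (gridPoint (gridSucc i (gridCell k y))))) 0)
        atTop (𝓝 a) := by
  have hae := ae_differentiableAt_of_lipschitzOn_Icc (lipschitzOnWith_of_abs_sub_le_mul_sum hL hf)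
  have hbound : ∀ (k : ℕ) (y : ι → ℝ), ‖max ((k + 1 : ℝ) *
      (f (gridPoint (gridCell k y)) - f (gridPoint (gridSucc i (gridCell k y))))) 0‖ ≤ L := by
    intro k y
    rw [Real.norm_of_nonneg (le_max_right _ _)]
    refine max_le ?_ hL
    have h := (le_abs_self _).trans (abs_sub_gridSucc_le hL hf i (gridCell k y))
    calc _ ≤ (k + 1 : ℝ) * (L * (1 / (k + 1))) := mul_le_mul_of_nonneg_left h (by positivity)
      _ = L := by field_simp
  have hlim : ∀ᵐ y ∂volume.restrict (Set.Icc (0 : ι → ℝ) 1),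
      Tendsto (fun k : ℕ => max ((k + 1 : ℝ) *
        (f (gridPoint (gridCell k y)) - f (gridPoint (gridSucc i (gridCell k y))))) 0)
        atTop (𝓝 (max (-fderiv ℝ f y (Pi.single i 1)) 0)) := by
    filter_upwards [hae] with y hy
    exact (tendsto_gridCell_quotient hy.2.2.hasFDerivAt hy.1 (hy.2.1 i)).max tendsto_const_nhds
  refine ⟨∫ y in Set.Icc (0 : ι → ℝ) 1, max (-fderiv ℝ f y (Pi.single i 1)) 0, ?_,
    tendsto_integral_of_dominated_convergence (fun _ => L)
      (fun k => (integrableOn_comp_gridCell k fun x => max ((k + 1 : ℝ) *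
        (f (gridPoint x) - f (gridPoint (gridSucc i x)))) 0).aestronglyMeasurable)
      (integrableOn_const isCompact_Icc.measure_ne_top)
      (fun k => ae_of_all _ (hbound k)) hlim⟩
  set S := {x : ι → ℝ | x ∈ Set.Icc 0 1 ∧
        DifferentiableAt ℝ f x ∧ fderiv ℝ f x (Pi.single i 1) < 0} with hS
  have hSm : MeasurableSet S := measurableSet_Icc.inter
    ((measurableSet_of_differentiableAt ℝ f).inter
      (measurableSet_lt (measurable_fderiv_apply_const ℝ f _) measurable_const))
  have hle : (fun y => max (-fderiv ℝ f y (Pi.single i 1)) 0)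
      ≤ᵐ[volume.restrict (Set.Icc (0 : ι → ℝ) 1)] S.indicator fun _ => L := by
    filter_upwards [hae, hlim] with y hy hl
    by_cases hyS : y ∈ S
    · rw [Set.indicator_of_mem hyS]
      exact le_of_tendsto' hl fun k => (le_abs_self _).trans (hbound k y)
    · rw [Set.indicator_of_notMem hyS]
      refine max_le ?_ le_rfl
      have : ¬ fderiv ℝ f y (Pi.single i 1) < 0 := fun h => hyS ⟨hy.1, hy.2.2, h⟩
      linarith
  have hSsub : S ⊆ Set.Icc 0 1 := fun x hx => hx.1
  refine (integral_mono_of_nonneg (ae_of_all _ fun y => le_max_right _ _)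
    (IntegrableOn.indicator (integrableOn_const (C := L) isCompact_Icc.measure_ne_top) hSm
      : IntegrableOn _ _ _) hle).trans_eq ?_
  rw [setIntegral_indicator hSm, Set.inter_eq_right.mpr hSsub, setIntegral_const, smul_eq_mul,
    mul_comm, measureReal_def]

end Lipschitz

/-- **Far-from-monotone Lipschitz functions have many negative partial derivatives.**
If `f : [0,1]ⁿ → ℝ` is `(ℓ¹, L)`-Lipschitz and its `L¹` distance to monotonicity exceeds
`ε`, then the sets `Sᵢ = {x ∈ [0,1]ⁿ : f differentiable at x and ∂ᵢf(x) < 0}` satisfy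
`Σᵢ ν(Sᵢ) > ε / (2L)`. -/
theorem sum_volume_negative_partials {n : ℕ} (L ε : ℝ) (hL : 0 < L) (hε : 0 < ε)
    (f : (Fin n → ℝ) → ℝ)
    (hf : ∀ x ∈ Set.Icc (0 : Fin n → ℝ) 1, ∀ y ∈ Set.Icc (0 : Fin n → ℝ) 1,
      |f x - f y| ≤ L * ∑ i, |x i - y i|)
    (hd : ε < sInf {d : ℝ | ∃ g : (Fin n → ℝ) → ℝ, MonotoneOn g (Set.Icc 0 1) ∧
      IntegrableOn g (Set.Icc 0 1) ∧
      d = ∫ x in Set.Icc (0 : Fin n → ℝ) 1, |f x - g x|}) :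
    ε / (2 * L) <
      ∑ i : Fin n, (volume {x : Fin n → ℝ | x ∈ Set.Icc 0 1 ∧
        DifferentiableAt ℝ f x ∧ fderiv ℝ f x (Pi.single i 1) < 0}).toReal := by
  choose a ha hlim using exists_tendsto_integral_quotient_le hL.le hf
  set d := sInf {d : ℝ | ∃ g : (Fin n → ℝ) → ℝ, MonotoneOn g (Set.Icc 0 1) ∧
    IntegrableOn g (Set.Icc 0 1) ∧ d = ∫ x in Set.Icc (0 : Fin n → ℝ) 1, |f x - g x|}
  have hda : d ≤ ∑ i, a i := by
    have ht : Filter.Tendsto (fun k : ℕ => L * Fintype.card (Fin n) * (1 / (k + 1) : ℝ) +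
        ∑ i, ∫ y in Set.Icc (0 : Fin n → ℝ) 1, max ((k + 1 : ℝ) * (f (gridPoint (gridCell k y)) -
          f (gridPoint (gridSucc i (gridCell k y))))) 0) Filter.atTop (nhds (∑ i, a i)) := by
      simpa using (tendsto_one_div_add_atTop_nhds_zero_nat.const_mul
        (L * Fintype.card (Fin n))).add (tendsto_finsetSum _ fun i _ => hlim i)
    refine ge_of_tendsto' ht fun k => ?_
    obtain ⟨g, hg, hgi, hle⟩ := exists_monotone_integral_abs_sub_le hL.le hf k
    have hd0 : d ≤ ∫ x in Set.Icc (0 : Fin n → ℝ) 1, |f x - g x| := by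
      refine csInf_le ⟨0, ?_⟩ ⟨g, hg.monotoneOn _, hgi, rfl⟩
      rintro _ ⟨g, -, -, rfl⟩
      exact integral_nonneg fun _ => abs_nonneg _
    exact hd0.trans hle
  have hsum := Finset.sum_le_sum fun i (_ : i ∈ Finset.univ) => ha i
  rw [← Finset.mul_sum] at hsum
  rw [div_lt_iff₀ (by positivity)]
  linarith
end

section
/- Let m, L, ε > 0 and let f : [0,m] → ℝ be L-Lipschitz (|f(x) − f(y)| ≤ L|x − y|). Let m' be an integer with m' ≥ 4mL/ε, set δ := m/m', and define the discretized function f̄ : [m'] → ℝ by f̄(i) = f(δ·i) for each i ∈ [m']. If d₁(f) > ε, then d₁(f̄) > ε/4, where d₁(f) = inf over monotone g of (1/m)·∫₀^m |f − g| dν and d₁(f̄) = inf over monotone ḡ : [m'] → ℝ of (1/m')·Σ_{i=1}^{m'} |f̄(i) − ḡ(i)|. -/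
open MeasureTheory

/-- A monotone sequence `g` of length `n`, extended to a monotone step function on the line which
takes the value `g i` on `(δ * i, δ * (i + 1)]`. -/
theorem exists_monotone_step {n : ℕ} (hn : 0 < n) {δ : ℝ} (hδ : 0 < δ) {g : Fin n → ℝ}
    (hg : Monotone g) :
    ∃ G : ℝ → ℝ, Monotone G ∧
      ∀ i : Fin n, ∀ x ∈ Set.Ioc (δ * (i : ℕ)) (δ * ((i : ℕ) + 1)), G x = g i := by
  refine ⟨fun x => g ⟨min (⌈x / δ⌉₊ - 1) (n - 1), by omega⟩, fun x y hxy => hg ?_, ?_⟩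
  · have h : ⌈x / δ⌉₊ ≤ ⌈y / δ⌉₊ := Nat.ceil_mono (by gcongr)
    rw [Fin.mk_le_mk]
    omega
  · rintro i x ⟨h1, h2⟩
    have hc : ⌈x / δ⌉₊ = (i : ℕ) + 1 := by
      rw [Nat.ceil_eq_iff (by omega)]
      push_cast
      rw [lt_div_iff₀ hδ, div_le_iff₀ hδ]
      constructor
      · simpa [mul_comm] using h1
      · linarith
    have hi := i.isLt
    refine congrArg g (Fin.ext ?_)
    simp only [hc]
    omega

/-- If `f` is `L`-Lipschitz and `G` equals `c i` on the `i`-th of `n` cells of length `δ`, the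
`L¹` distance of `f` and `G` is controlled by the discrete distance sampled at the right
endpoints. -/
theorem integral_abs_sub_step_le {L δ : ℝ} (hL : 0 ≤ L) (hδ : 0 < δ) {n : ℕ} {f G : ℝ → ℝ}
    (hf : ∀ x ∈ Set.Icc (0 : ℝ) (δ * n), ∀ y ∈ Set.Icc (0 : ℝ) (δ * n),
      |f x - f y| ≤ L * |x - y|)
    (hint : IntegrableOn (fun x => |f x - G x|) (Set.Icc 0 (δ * n))) {c : Fin n → ℝ}
    (hG : ∀ i : Fin n, ∀ x ∈ Set.Ioc (δ * (i : ℕ)) (δ * ((i : ℕ) + 1)), G x = c i) :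
    ∫ x in Set.Icc (0 : ℝ) (δ * n), |f x - G x| ≤
      δ * ∑ i : Fin n, |f (δ * ((i : ℕ) + 1)) - c i| + n * (L * δ ^ 2) := by
  have hcell : ∀ k < n, 0 ≤ δ * k ∧ δ * k ≤ δ * (k + 1) ∧ δ * ((k : ℝ) + 1) ≤ δ * n := by
    intro k hk
    have hk' : (k : ℝ) + 1 ≤ n := by exact_mod_cast hk
    exact ⟨by positivity, by gcongr; linarith, by gcongr⟩
  have hsum : ∑ k ∈ Finset.range n, ∫ x in (δ * (k : ℕ))..(δ * ((k + 1 : ℕ) : ℝ)), |f x - G x| =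
      ∫ x in (δ * ((0 : ℕ) : ℝ))..(δ * n), |f x - G x| := by
    refine intervalIntegral.sum_integral_adjacent_intervals (a := fun k : ℕ => δ * (k : ℝ)) ?_
    intro k hk
    obtain ⟨h0, h1, h2⟩ := hcell k hk
    push_cast
    rw [intervalIntegrable_iff_integrableOn_Icc_of_le h1]
    exact hint.mono_set (Set.Icc_subset_Icc h0 h2)
  have hI : ∫ x in Set.Icc (0 : ℝ) (δ * n), |f x - G x| =
      ∑ i : Fin n, ∫ x in (δ * (i : ℕ))..(δ * ((i : ℕ) + 1)), |f x - G x| := by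
    rw [integral_Icc_eq_integral_Ioc, ← intervalIntegral.integral_of_le (by positivity)]
    rw [Nat.cast_zero, mul_zero] at hsum
    rw [← hsum, Finset.sum_range]
    push_cast
    rfl
  have hbound : ∀ i : Fin n, ∫ x in (δ * (i : ℕ))..(δ * ((i : ℕ) + 1)), |f x - G x| ≤
      δ * |f (δ * ((i : ℕ) + 1)) - c i| + L * δ ^ 2 := by
    intro i
    obtain ⟨h0, h1, h2⟩ := hcell i i.isLt
    have hnorm := intervalIntegral.norm_integral_le_of_norm_le_const
      (a := δ * (i : ℕ)) (b := δ * ((i : ℕ) + 1)) (f := fun x => |f x - G x|)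
      (C := |f (δ * ((i : ℕ) + 1)) - c i| + L * δ) ?_
    · have hlen : |δ * (((i : ℕ) : ℝ) + 1) - δ * (i : ℕ)| = δ := by
        rw [show δ * (((i : ℕ) : ℝ) + 1) - δ * (i : ℕ) = δ by ring, abs_of_pos hδ]
      rw [hlen] at hnorm
      refine (le_abs_self _).trans (hnorm.trans (le_of_eq ?_))
      ring
    · intro x hx
      rw [Set.uIoc_of_le h1] at hx
      rw [hG i x hx, Real.norm_eq_abs, abs_abs]
      have hlip := hf x ⟨h0.trans hx.1.le, hx.2.trans h2⟩ (δ * ((i : ℕ) + 1))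
        ⟨h0.trans h1, h2⟩
      have hdist : |x - δ * (((i : ℕ) : ℝ) + 1)| ≤ δ := by
        rw [abs_le]
        constructor <;> linarith [hx.1, hx.2]
      have htri := abs_sub_le (f x) (f (δ * ((i : ℕ) + 1))) (c i)
      linarith [mul_le_mul_of_nonneg_left hdist hL]
  calc ∫ x in Set.Icc (0 : ℝ) (δ * n), |f x - G x|
      ≤ ∑ i : Fin n, (δ * |f (δ * ((i : ℕ) + 1)) - c i| + L * δ ^ 2) :=
        hI.trans_le (Finset.sum_le_sum fun i _ => hbound i)
    _ = _ := by
        rw [Finset.sum_add_distrib, ← Finset.mul_sum]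
        simp

/-- **Discretization preserves distance to monotonicity.**
Let `f : [0,m] → ℝ` be `L`-Lipschitz, let `m' ≥ 4mL/ε` be an integer, `δ = m/m'`, and let
`f̄ : [m'] → ℝ` be the discretization `f̄(i) = f(δ·i)`. If the (normalized) `L¹` distance
of `f` to the monotone functions on `[0,m]` exceeds `ε`, then the normalized `L¹` distance
of `f̄` to the monotone functions on `[m']` exceeds `ε/4`.
(Here `Fin m'` represents `[m'] = {1, …, m'}`, the point `i : Fin m'` standing for
`i + 1`.) -/
theorem discretization_preserves_distance (m L ε : ℝ) (hm : 0 < m) (hL : 0 < L)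
    (hε : 0 < ε) (f : ℝ → ℝ)
    (hf : ∀ x ∈ Set.Icc (0 : ℝ) m, ∀ y ∈ Set.Icc (0 : ℝ) m, |f x - f y| ≤ L * |x - y|)
    (m' : ℕ) (hm' : 4 * m * L / ε ≤ (m' : ℝ))
    (hd : ε < sInf {d : ℝ | ∃ g : ℝ → ℝ, MonotoneOn g (Set.Icc 0 m) ∧
      IntegrableOn g (Set.Icc 0 m) ∧
      d = (1 / m) * ∫ x in Set.Icc (0 : ℝ) m, |f x - g x|}) :
    ε / 4 < sInf {d : ℝ | ∃ g : Fin m' → ℝ, Monotone g ∧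
      d = (1 / (m' : ℝ)) * ∑ i : Fin m', |f ((m / (m' : ℝ)) * ((i : ℕ) + 1)) - g i|} := by
  have hn : (0 : ℝ) < m' := lt_of_lt_of_le (by positivity) hm'
  have hδ : 0 < m / m' := by positivity
  have hδm : m / m' * m' = m := div_mul_cancel₀ m hn.ne'
  have hLδ : L * (m / m') ≤ ε / 4 := by
    rw [div_le_iff₀ hε] at hm'
    rw [← mul_div_assoc, div_le_iff₀ hn]
    linarith
  have hfc : ContinuousOn f (Set.Icc 0 m) :=
    (LipschitzOnWith.of_dist_le_mul (K := ⟨L, hL.le⟩) fun x hx y hy => hf x hx y hy).continuousOn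
  set D : Set ℝ := {d : ℝ | ∃ g : ℝ → ℝ, MonotoneOn g (Set.Icc 0 m) ∧
      IntegrableOn g (Set.Icc 0 m) ∧
      d = (1 / m) * ∫ x in Set.Icc (0 : ℝ) m, |f x - g x|}
  have hbdd : BddBelow D := by
    refine ⟨0, ?_⟩
    rintro _ ⟨h, -, -, rfl⟩
    exact mul_nonneg (by positivity) (integral_nonneg fun _ => abs_nonneg _)
  refine lt_of_lt_of_le (b := sInf D - ε / 4) (by linarith) ?_
  refine le_csInf ⟨_, fun _ => 0, monotone_const, rfl⟩ ?_
  rintro _ ⟨g, hg, rfl⟩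
  obtain ⟨G, hGmono, hG⟩ := exists_monotone_step (by exact_mod_cast hn) hδ hg
  have hGint : IntegrableOn G (Set.Icc 0 m) :=
    (hGmono.monotoneOn _).integrableOn_isCompact isCompact_Icc
  have hint : IntegrableOn (fun x => |f x - G x|) (Set.Icc 0 m) :=
    ((hfc.integrableOn_compact isCompact_Icc).sub hGint).abs
  have hle := integral_abs_sub_step_le hL.le hδ (n := m') (f := f) (G := G)
    (by rwa [hδm]) (by rwa [hδm]) hG
  rw [hδm] at hle
  rw [sub_le_iff_le_add]
  refine (csInf_le hbdd ⟨G, hGmono.monotoneOn _, hGint, rfl⟩).trans ?_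
  refine (mul_le_mul_of_nonneg_left hle (by positivity)).trans ?_
  refine le_trans (le_of_eq ?_) (add_le_add_right hLδ _)
  field_simp
end

section
/- Let f̄ : [m'] → ℝ satisfy |f̄(i) − f̄(j)| ≤ L'·|i − j| for all i, j ∈ [m']. Then d₀(f̄) ≥ sqrt( d₁(f̄) / (m'·L') ), where d₀(f̄) is the normalized Hamming distance from f̄ to the set of monotone (non-decreasing) functions and d₁(f̄) is the normalized L¹ distance from f̄ to the set of monotone functions. -/
/-- A monotone retraction onto a nonempty set `S` of `Fin n` which moves each point by at most
the number of points outside `S`. -/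
theorem exists_monotone_retraction {n : ℕ} (S : Finset (Fin n)) (hS : S.Nonempty) :
    ∃ p : Fin n → Fin n, Monotone p ∧ (∀ i, p i ∈ S) ∧ (∀ i ∈ S, p i = i) ∧
      ∀ i : Fin n, |((i : ℕ) : ℝ) - ((p i : ℕ) : ℝ)| ≤ (Sᶜ.card : ℝ) := by
  set a := S.min' hS
  have haS : a ∈ S := S.min'_mem hS
  have hne : ∀ i, (S.filter (· ≤ max i a)).Nonempty := fun i =>
    ⟨a, Finset.mem_filter.2 ⟨haS, le_max_right _ _⟩⟩
  set p : Fin n → Fin n := fun i => (S.filter (· ≤ max i a)).max' (hne i)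
  have hmem : ∀ i, p i ∈ S ∧ p i ≤ max i a := fun i =>
    Finset.mem_filter.1 (Finset.max'_mem _ (hne i))
  have hle : ∀ i, ∀ s ∈ S, s ≤ max i a → s ≤ p i := fun i s hs hsi =>
    Finset.le_max' _ _ (Finset.mem_filter.2 ⟨hs, hsi⟩)
  refine ⟨p, fun i j hij => ?_, fun i => (hmem i).1, fun i hi => ?_, fun i => ?_⟩
  · exact hle j _ (hmem i).1 ((hmem i).2.trans (max_le_max_right a hij))
  · have hai : a ≤ i := S.min'_le i hi
    refine le_antisymm ?_ (hle i i hi (le_max_left _ _))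
    simpa [max_eq_left hai] using (hmem i).2
  · rcases le_total a i with hai | hia
    · have h1 : p i ≤ i := by simpa [max_eq_left hai] using (hmem i).2
      have hsub : Finset.Ioc (p i) i ⊆ Sᶜ := fun s hs => by
        rw [Finset.mem_Ioc] at hs
        rw [Finset.mem_compl]
        exact fun hsS => absurd (hle i s hsS (hs.2.trans (le_max_left _ _))) (not_le.2 hs.1)
      have hc := Finset.card_le_card hsub
      rw [Fin.card_Ioc, Nat.sub_le_iff_le_add] at hc
      have h2 : ((p i : ℕ) : ℝ) ≤ ((i : ℕ) : ℝ) := by exact_mod_cast h1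
      have h3 : ((i : ℕ) : ℝ) ≤ Sᶜ.card + ((p i : ℕ) : ℝ) := by exact_mod_cast hc
      rw [abs_of_nonneg (by linarith)]
      linarith
    · have h1 : p i = a :=
        le_antisymm (by simpa [max_eq_right hia] using (hmem i).2)
          (hle i a haS (le_max_right _ _))
      have hsub : Finset.Ico i a ⊆ Sᶜ := fun s hs => by
        rw [Finset.mem_Ico] at hs
        rw [Finset.mem_compl]
        exact fun hsS => absurd (S.min'_le s hsS) (not_le.2 hs.2)
      have hc := Finset.card_le_card hsub
      rw [Fin.card_Ico, Nat.sub_le_iff_le_add] at hc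
      have h2 : ((i : ℕ) : ℝ) ≤ ((a : ℕ) : ℝ) := by exact_mod_cast hia
      have h3 : ((a : ℕ) : ℝ) ≤ Sᶜ.card + ((i : ℕ) : ℝ) := by exact_mod_cast hc
      rw [h1, abs_of_nonpos (by linarith)]
      linarith

/-- A Lipschitz function on `Fin n` which is monotone on `S` is within `ℓ¹` distance
`L * #Sᶜ ^ 2` of a monotone function. -/
theorem exists_monotone_sum_abs_sub_le_s14 {n : ℕ} {L : ℝ} (hL : 0 ≤ L) (f : Fin n → ℝ)
    (hf : ∀ i j : Fin n, |f i - f j| ≤ L * |((i : ℕ) : ℝ) - ((j : ℕ) : ℝ)|)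
    (S : Finset (Fin n)) (hS : MonotoneOn f S) :
    ∃ h : Fin n → ℝ, Monotone h ∧ ∑ i, |f i - h i| ≤ L * (Sᶜ.card : ℝ) ^ 2 := by
  suffices H : ∃ h : Fin n → ℝ, Monotone h ∧ (∀ i ∈ S, h i = f i) ∧
      ∀ i, |f i - h i| ≤ L * Sᶜ.card by
    obtain ⟨h, hmono, heq, hle⟩ := H
    refine ⟨h, hmono, ?_⟩
    calc ∑ i, |f i - h i| = ∑ i ∈ Sᶜ, |f i - h i| := by
          refine (Finset.sum_subset (Finset.subset_univ _) fun i _ hi => ?_).symm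
          rw [heq i (by simpa using hi), sub_self, abs_zero]
      _ ≤ ∑ _i ∈ Sᶜ, L * (Sᶜ.card : ℝ) := Finset.sum_le_sum fun i _ => hle i
      _ = L * (Sᶜ.card : ℝ) ^ 2 := by rw [Finset.sum_const, nsmul_eq_mul]; ring
  rcases S.eq_empty_or_nonempty with rfl | hne
  · rcases n with _ | n
    · exact ⟨f, fun i => i.elim0, fun _ _ => rfl, fun i => i.elim0⟩
    · refine ⟨fun _ => f 0, monotone_const, by simp, fun i => (hf i 0).trans ?_⟩
      refine mul_le_mul_of_nonneg_left ?_ hL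
      have hi : ((i : ℕ) : ℝ) ≤ ((n + 1 : ℕ) : ℝ) := by exact_mod_cast i.2.le
      simpa using hi
  · obtain ⟨p, hp, hpS, hfix, hdist⟩ := exists_monotone_retraction S hne
    refine ⟨fun i => f (p i), fun i j hij => hS (hpS i) (hpS j) (hp hij),
      fun i hi => congrArg f (hfix i hi), fun i => (hf i (p i)).trans ?_⟩
    exact mul_le_mul_of_nonneg_left (hdist i) hL

/-- **Far in `L¹` distance implies far in Hamming distance.**
If `f̄ : [m'] → ℝ` is `L'`-Lipschitz, then `d₀(f̄) ≥ √(d₁(f̄) / (m' L'))`, where `d₀`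
(resp. `d₁`) is the normalized Hamming (resp. `L¹`) distance from `f̄` to the monotone
(non-decreasing) functions on `[m']`, under the uniform measure. -/
theorem l1_far_implies_hamming_far {m' : ℕ} (L' : ℝ) (f : Fin m' → ℝ)
    (hf : ∀ i j : Fin m', |f i - f j| ≤ L' * |((i : ℕ) : ℝ) - ((j : ℕ) : ℝ)|) :
    Real.sqrt
        ((sInf {d : ℝ | ∃ g : Fin m' → ℝ, Monotone g ∧
            d = (1 / (m' : ℝ)) * ∑ i, |f i - g i|}) / ((m' : ℝ) * L')) ≤
      sInf {d : ℝ | ∃ g : Fin m' → ℝ, Monotone g ∧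
        d = ({i : Fin m' | f i ≠ g i}.ncard : ℝ) / (m' : ℝ)} := by
  set d₁ := sInf {d : ℝ | ∃ g : Fin m' → ℝ, Monotone g ∧
    d = (1 / (m' : ℝ)) * ∑ i, |f i - g i|}
  have hlow : ∀ d ∈ {d : ℝ | ∃ g : Fin m' → ℝ, Monotone g ∧
      d = (1 / (m' : ℝ)) * ∑ i, |f i - g i|}, 0 ≤ d := by
    rintro d ⟨g, -, rfl⟩
    positivity
  have hd₁_nonneg : 0 ≤ d₁ := Real.sInf_nonneg hlow
  refine le_csInf ⟨_, fun _ => 0, monotone_const, rfl⟩ ?_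
  rintro d ⟨g, hg, rfl⟩
  rcases le_or_gt L' 0 with hL | hL
  · rw [Real.sqrt_eq_zero_of_nonpos (div_nonpos_of_nonneg_of_nonpos hd₁_nonneg
      (mul_nonpos_of_nonneg_of_nonpos (Nat.cast_nonneg _) hL))]
    positivity
  rcases Nat.eq_zero_or_pos m' with rfl | hm
  · simp
  have hm' : (0 : ℝ) < m' := by exact_mod_cast hm
  classical
  set S : Finset (Fin m') := Finset.univ.filter fun i => f i = g i with hS
  have hcard : {i : Fin m' | f i ≠ g i}.ncard = Sᶜ.card := by
    rw [← Set.ncard_coe_finset]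
    congr 1
    ext i
    simp [hS]
  have hmono : MonotoneOn f S := fun i hi j hj hij => by
    have hi' : f i = g i := by simpa [hS] using hi
    have hj' : f j = g j := by simpa [hS] using hj
    rw [hi', hj']
    exact hg hij
  obtain ⟨h, hh, hsum⟩ := exists_monotone_sum_abs_sub_le_s14 hL.le f hf S hmono
  have hd₁_le : d₁ ≤ (1 / (m' : ℝ)) * (L' * (Sᶜ.card : ℝ) ^ 2) :=
    (csInf_le ⟨0, hlow⟩ ⟨h, hh, rfl⟩).trans
      (mul_le_mul_of_nonneg_left hsum (by positivity))
  rw [hcard]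
  refine Real.sqrt_le_iff.2 ⟨by positivity, ?_⟩
  rw [div_le_iff₀ (by positivity)]
  refine hd₁_le.trans_eq ?_
  field_simp
end

section
/- Let m > 0, let f : [0,m] → ℝ be absolutely continuous with monotone rearrangement f*, and let x ∈ [0,m]. Then there exists x' ∈ [0,x] such that f(x') ≥ f*(x). -/
open MeasureTheory

/-- A function with an integral representation on `[0, m]` is continuous there. -/
theorem continuousOn_of_eq_add_integral {m : ℝ} (hm : 0 ≤ m) {f f' : ℝ → ℝ}
    (hf' : IntegrableOn f' (Set.Icc 0 m))
    (hrep : ∀ x ∈ Set.Icc (0 : ℝ) m, f x = f 0 + ∫ t in (0 : ℝ)..x, f' t) :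
    ContinuousOn f (Set.Icc 0 m) := by
  have h : ContinuousOn (fun x => ∫ t in (0 : ℝ)..x, f' t) (Set.uIcc 0 m) :=
    intervalIntegral.continuousOn_primitive_interval (by rwa [Set.uIcc_of_le hm])
  rw [Set.uIcc_of_le hm] at h
  exact (continuousOn_const.add h).congr hrep

/-- If `g` is bounded below by `b` on `[0, m]` and above by `c` on `[0, x]`, then its monotone
rearrangement at `x` is at most `c`. -/
theorem rearr1_le {m b c x : ℝ} {g : ℝ → ℝ} (hx : x ∈ Set.Icc 0 m)
    (hb : ∀ y ∈ Set.Icc 0 m, b ≤ g y) (hc : ∀ y ∈ Set.Icc 0 x, g y ≤ c) :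
    rearr1 m g x ≤ c := by
  have hsub : Set.Icc 0 x ⊆ levelSet m g c :=
    fun y hy => ⟨⟨hy.1, hy.2.trans hx.2⟩, hc y hy⟩
  refine csInf_le ⟨b, ?_⟩ ⟨⟨0, hsub ⟨le_rfl, hx.1⟩⟩, hx.1, ?_⟩
  · rintro d ⟨⟨y, hy, hyd⟩, -⟩
    exact (hb y hy).trans hyd
  · simpa using measure_mono (μ := volume) hsub

/-- For an absolutely continuous `f : [0,m] → ℝ` (with a.e. derivative `f' ∈ L¹(0,m)` and
`f(x) = f(0) + ∫₀ˣ f'`) with monotone rearrangement `f*`, and any `x ∈ [0,m]`, there is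
`x' ∈ [0,x]` with `f(x') ≥ f*(x)`. -/
theorem exists_point_above_rearrangement (m : ℝ) (hm : 0 < m) (f f' : ℝ → ℝ)
    (hf' : IntegrableOn f' (Set.Icc 0 m))
    (hrep : ∀ x ∈ Set.Icc (0 : ℝ) m, f x = f 0 + ∫ t in (0 : ℝ)..x, f' t)
    (x : ℝ) (hx : x ∈ Set.Icc (0 : ℝ) m) :
    ∃ x' ∈ Set.Icc (0 : ℝ) x, rearr1 m f x ≤ f x' := by
  have hcont := continuousOn_of_eq_add_integral hm.le hf' hrep
  obtain ⟨y, -, hy⟩ := isCompact_Icc.exists_isMinOn (Set.nonempty_Icc.2 hm.le) hcont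
  obtain ⟨x', hx', hmax⟩ := isCompact_Icc.exists_isMaxOn (Set.nonempty_Icc.2 hx.1)
    (hcont.mono (Set.Icc_subset_Icc_right hx.2))
  exact ⟨x', hx', rearr1_le hx (fun z hz => hy hz) (fun z hz => hmax hz)⟩
end

section
/- For every n ∈ ℕ there exists a constant C(n) > 0 with the following property. Let r > 0 and c ∈ [0,1]ⁿ be such that the ℓ¹-ball B₁ⁿ(r, c) = {y ∈ ℝⁿ : ‖y − c‖₁ ≤ r} is contained in [0,1]ⁿ, and define f : [0,1]ⁿ → ℝ by f(x) = −r + ‖x − c‖₁ for x ∈ B₁ⁿ(r, c) and f(x) = 0 otherwise. Then f satisfies |f(x) − f(y)| ≤ ‖x − y‖₁ for all x, y, and for every monotone g ∈ L¹([0,1]ⁿ), ∫_{[0,1]ⁿ} |f − g| dν ≥ C(n)·r^{n+1}, where ν is the Lebesgue measure; in particular d₁(f) ≥ C(n)·r^{n+1}. -/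
open MeasureTheory

/-- The "hole" function: `f(x) = −r + ‖x − c‖₁` inside the `ℓ¹`-ball `B₁ⁿ(r, c)`, and
`f(x) = 0` outside of it. -/
noncomputable def ballFun (n : ℕ) (c : Fin n → ℝ) (r : ℝ) : (Fin n → ℝ) → ℝ :=
  fun x => if (∑ i, |x i - c i|) ≤ r then -r + ∑ i, |x i - c i| else 0

theorem ballFun_eq_min (n : ℕ) (c : Fin n → ℝ) (r : ℝ) (x : Fin n → ℝ) :
    ballFun n c r x = min ((∑ i, |x i - c i|) - r) 0 := by
  unfold ballFun
  split_ifs with h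
  · rw [min_eq_left (by linarith)]
    ring
  · rw [min_eq_right (by linarith)]

theorem continuous_ballFun (n : ℕ) (c : Fin n → ℝ) (r : ℝ) : Continuous (ballFun n c r) := by
  rw [funext (ballFun_eq_min n c r)]
  fun_prop

theorem abs_ballFun_sub_le (n : ℕ) (c : Fin n → ℝ) (r : ℝ) (x y : Fin n → ℝ) :
    |ballFun n c r x - ballFun n c r y| ≤ ∑ i, |x i - y i| := by
  rw [ballFun_eq_min, ballFun_eq_min]
  refine (abs_min_sub_min_le_max _ _ _ _).trans (max_le ?_ ?_)
  · rw [sub_sub_sub_cancel_right, ← Finset.sum_sub_distrib]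
    refine (Finset.abs_sum_le_sum_abs _ _).trans (Finset.sum_le_sum fun i _ => ?_)
    refine (abs_abs_sub_abs_le _ _).trans_eq ?_
    rw [sub_sub_sub_cancel_right]
  · simpa using Finset.sum_nonneg fun i _ => abs_nonneg (x i - y i)

/-- If `F ≥ 0` satisfies `F y + F (y - v) ≥ δ` for all `y ∈ Q`, where both `Q` and its translate
`Q - v` are contained in `K`, then `δ · vol(Q) ≤ 2 ∫_K F`. -/
theorem mul_volume_le_two_mul_setIntegral {n : ℕ} {F : (Fin n → ℝ) → ℝ} {K Q : Set (Fin n → ℝ)}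
    {v : Fin n → ℝ} {δ : ℝ} (hF : ∀ x, 0 ≤ F x) (hFK : IntegrableOn F K)
    (hQ : MeasurableSet Q) (hQK : Q ⊆ K) (hQv : ∀ y ∈ Q, y - v ∈ K)
    (hδ : ∀ y ∈ Q, δ ≤ F y + F (y - v)) (hfin : volume Q ≠ ⊤) :
    δ * volume.real Q ≤ 2 * ∫ x in K, F x := by
  have mp := measurePreserving_sub_right (volume : Measure (Fin n → ℝ)) v
  have me : MeasurableEmbedding fun y : Fin n → ℝ => y - v := measurableEmbedding_subRight v
  have hFv : IntegrableOn (fun y => F (y - v)) ((fun y => y - v) ⁻¹' K) :=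
    (mp.integrableOn_comp_preimage me).2 hFK
  have h1 : ∫ y in Q, F y ≤ ∫ y in K, F y :=
    setIntegral_mono_set hFK (.of_forall hF) (LE.le.eventuallyLE hQK)
  have h2 : ∫ y in Q, F (y - v) ≤ ∫ y in K, F y := by
    rw [← mp.setIntegral_preimage_emb me F K]
    exact setIntegral_mono_set hFv (.of_forall fun y => hF _) (LE.le.eventuallyLE hQv)
  have h3 : ∫ _ in Q, δ ≤ ∫ y in Q, (F y + F (y - v)) :=
    setIntegral_mono_on (integrableOn_const hfin)
      ((hFK.mono_set hQK).add (hFv.mono_set hQv)) hQ hδ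
  rw [integral_add (hFK.mono_set hQK) (hFv.mono_set hQv), setIntegral_const, smul_eq_mul] at h3
  linarith

theorem ballFun_integral_lower_bound (n : ℕ) (hn : 0 < n) {r : ℝ} (hr : 0 < r) (c : Fin n → ℝ)
    (hball : {y : Fin n → ℝ | (∑ i, |y i - c i|) ≤ r} ⊆ Set.Icc 0 1)
    {g : (Fin n → ℝ) → ℝ} (hg : MonotoneOn g (Set.Icc 0 1))
    (hgi : IntegrableOn g (Set.Icc 0 1)) :
    1 / (4 * (4 * (n : ℝ)) ^ n) * r ^ (n + 1) ≤
      ∫ x in Set.Icc (0 : Fin n → ℝ) 1, |ballFun n c r x - g x| := by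
  have hn' : (0 : ℝ) < n := by exact_mod_cast hn
  set h : ℝ := r / (8 * n) with hh
  set Q : Set (Fin n → ℝ) := Set.Icc (fun i => c i - h) (fun i => c i + h) with hQ
  set v : Fin n → ℝ := Pi.single ⟨0, hn⟩ (3 * r / 4) with hv
  have hv0 : 0 ≤ v := Pi.single_nonneg.2 (by positivity)
  have hvsum : ∑ i, |v i| = 3 * r / 4 := by
    rw [Finset.sum_congr rfl fun i _ => abs_of_nonneg (hv0 i), hv, Finset.sum_pi_single']
    simp
  have hQsum : ∀ y ∈ Q, ∑ i, |y i - c i| ≤ r / 8 := by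
    intro y hy
    calc ∑ i, |y i - c i| ≤ ∑ _i : Fin n, h := Finset.sum_le_sum fun i _ => by
          have h1 := hy.1 i
          have h2 := hy.2 i
          exact abs_le.2 ⟨by linarith, by linarith⟩
      _ = r / 8 := by
          rw [Finset.sum_const, Finset.card_univ, Fintype.card_fin, nsmul_eq_mul, hh]
          field_simp
  have hshift_le : ∀ y, ∑ i, |(y - v) i - c i| ≤ (∑ i, |y i - c i|) + 3 * r / 4 := by
    intro y
    rw [← hvsum, ← Finset.sum_add_distrib]
    refine Finset.sum_le_sum fun i _ => ?_
    rw [Pi.sub_apply, sub_right_comm]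
    exact abs_sub _ _
  have hshift_ge : ∀ y, 3 * r / 4 - ∑ i, |y i - c i| ≤ ∑ i, |(y - v) i - c i| := by
    intro y
    rw [← hvsum, ← Finset.sum_sub_distrib]
    refine Finset.sum_le_sum fun i _ => ?_
    rw [Pi.sub_apply, sub_right_comm, abs_sub_comm (y i - c i) (v i)]
    exact abs_sub_abs_le_abs_sub _ _
  have hQK : Q ⊆ Set.Icc 0 1 := fun y hy => hball <| by
    have := hQsum y hy
    simp only [Set.mem_ofPred_eq]
    linarith
  have hQv : ∀ y ∈ Q, y - v ∈ Set.Icc (0 : Fin n → ℝ) 1 := fun y hy => hball <| by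
    have := hQsum y hy
    have := hshift_le y
    simp only [Set.mem_ofPred_eq]
    linarith
  have hgap : ∀ y ∈ Q,
      r / 2 ≤ |ballFun n c r y - g y| + |ballFun n c r (y - v) - g (y - v)| := by
    intro y hy
    have hy' := hQsum y hy
    have hmono : g (y - v) ≤ g y := hg (hQv y hy) (hQK hy) (sub_le_self _ hv0)
    have hcenter : ballFun n c r y ≤ -(7 * r / 8) := by
      rw [ballFun_eq_min]
      exact (min_le_left _ _).trans (by linarith)
    have hedge : -(3 * r / 8) ≤ ballFun n c r (y - v) := by
      rw [ballFun_eq_min]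
      have := hshift_ge y
      exact le_min (by linarith) (by linarith)
    have := neg_abs_le (ballFun n c r y - g y)
    have := le_abs_self (ballFun n c r (y - v) - g (y - v))
    linarith
  have hvol : volume.real Q = (r / (4 * n)) ^ n := by
    rw [measureReal_def, hQ, Real.volume_Icc_pi_toReal]
    · have : ∀ i, c i + h - (c i - h) = r / (4 * n) := fun i => by
        rw [hh]
        field_simp
        ring
      simp [this, div_pow]
    · intro i
      have : 0 < h := by positivity
      simp only
      linarith
  have key := mul_volume_le_two_mul_setIntegral
    (F := fun x => |ballFun n c r x - g x|) (fun _ => abs_nonneg _)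
    (((continuous_ballFun n c r).continuousOn.integrableOn_compact isCompact_Icc).sub hgi).abs
    measurableSet_Icc hQK hQv hgap isCompact_Icc.measure_lt_top.ne
  rw [hvol, div_pow] at key
  have : 1 / (4 * (4 * (n : ℝ)) ^ n) * r ^ (n + 1) = r / 2 * (r ^ n / (4 * n) ^ n) / 2 := by
    field_simp
    ring
  linarith

/-- **The "hole" construction is far from monotone.** For every `n ≥ 1` there is a
constant `C(n) > 0` such that whenever the `ℓ¹`-ball `B₁ⁿ(r, c)` with `r > 0` is contained
in `[0,1]ⁿ`, the function `f = ballFun n c r` is `(ℓ¹, 1)`-Lipschitz and every monotone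
`g ∈ L¹([0,1]ⁿ)` satisfies `∫ |f − g| dν ≥ C(n) rⁿ⁺¹`; in particular
`d₁(f) ≥ C(n) rⁿ⁺¹`. -/
theorem hole_construction_far_from_monotone (n : ℕ) (hn : 0 < n) :
    ∃ C : ℝ, 0 < C ∧
      ∀ r : ℝ, 0 < r → ∀ c : Fin n → ℝ, c ∈ Set.Icc (0 : Fin n → ℝ) 1 →
        {y : Fin n → ℝ | (∑ i, |y i - c i|) ≤ r} ⊆ Set.Icc 0 1 →
        (∀ x ∈ Set.Icc (0 : Fin n → ℝ) 1, ∀ y ∈ Set.Icc (0 : Fin n → ℝ) 1,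
          |ballFun n c r x - ballFun n c r y| ≤ ∑ i, |x i - y i|) ∧
        (∀ g : (Fin n → ℝ) → ℝ, MonotoneOn g (Set.Icc 0 1) →
          IntegrableOn g (Set.Icc 0 1) →
          C * r ^ (n + 1) ≤ ∫ x in Set.Icc (0 : Fin n → ℝ) 1, |ballFun n c r x - g x|) ∧
        C * r ^ (n + 1) ≤ sInf {d : ℝ | ∃ g : (Fin n → ℝ) → ℝ,
          MonotoneOn g (Set.Icc 0 1) ∧ IntegrableOn g (Set.Icc 0 1) ∧
          d = ∫ x in Set.Icc (0 : Fin n → ℝ) 1, |ballFun n c r x - g x|} := by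
  have hn' : (0 : ℝ) < n := by exact_mod_cast hn
  refine ⟨1 / (4 * (4 * (n : ℝ)) ^ n), by positivity, fun r hr c _ hball =>
    ⟨fun x _ y _ => abs_ballFun_sub_le n c r x y,
      fun g hg hgi => ballFun_integral_lower_bound n hn hr c hball hg hgi,
      le_csInf ⟨_, 0, monotoneOn_const, integrableOn_zero, rfl⟩ ?_⟩⟩
  rintro _ ⟨g, hg, hgi, rfl⟩
  exact ballFun_integral_lower_bound n hn hr c hball hg hgi
end
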